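/- For every function γ: ℕ → (0,∞) with γ_k → 0 as k → ∞, there exist a constant k_0 ∈ ℕ and a function ε: ℕ → (0,∞) with ε_k → 0 as k → ∞ such that for every k ≥ k_0 and every d with 2k·ln k − ln k − 1 + ε_k ≤ d ≤ 2k·ln k, the following holds w.h.p. for G = G(n,⌈dn/2⌉): G has no k-cover ζ: V → {0,1,...,k} that additionally satisfies (1) |ζ^{-1}(0)| ≤ n·k^{−2/3}; (2) | |ζ^{-1}(i)| − n/k | ≤ γ_k·n/k for all i ∈ {1,...,k}; and (3) at most (ln k)^9 indices i ∈ {1,...,k} have | |ζ^{-1}(i)| − n/k | > n/(k·(ln k)^3). -/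

import Mathlib

open Filter

/-- Uniform counting probability on a finite sample space `Ω`. -/
noncomputable def prob {Ω : Type*} (p : Ω → Prop) : ℝ :=
  (Nat.card {x : Ω // p x} : ℝ) / (Nat.card Ω : ℝ)

/-- The sample space of the random graph `G(n,m)`. -/
def GraphSpace (n m : ℕ) : Type :=
  {E : Finset (Sym2 (Fin n)) // E.card = m ∧ ∀ e ∈ E, ¬ e.IsDiag}

/-- A vertex `v` is stable under `ζ : V → {0,1,…,k}` (`none` plays the role of `0`):
`ζ v ≠ 0` and for every color `j ≠ ζ v` there are at least two neighbors `u` of `v`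
with `ζ u = j`. -/
def Stable {n k : ℕ} (E : Finset (Sym2 (Fin n))) (ζ : Fin n → Option (Fin k))
    (v : Fin n) : Prop :=
  ζ v ≠ none ∧ ∀ j : Fin k, some j ≠ ζ v →
    ∃ u₁ u₂ : Fin n, u₁ ≠ u₂ ∧ s(v, u₁) ∈ E ∧ s(v, u₂) ∈ E ∧
      ζ u₁ = some j ∧ ζ u₂ = some j

/-- `ζ` is a `k`-cover of the graph with edge set `E` (conditions CV1–CV3). -/
def IsCover {n k : ℕ} (E : Finset (Sym2 (Fin n))) (ζ : Fin n → Option (Fin k)) : Prop :=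
  -- CV1: no edge has both endpoints of the same nonzero color
  (∀ u v : Fin n, s(u, v) ∈ E → ζ u = ζ v → ζ u = none) ∧
  -- CV2: every vertex with nonzero color is stable
  (∀ v : Fin n, ζ v ≠ none → Stable E ζ v) ∧
  -- CV3: every `0`-colored vertex misses one color and sees another at most once
  (∀ v : Fin n, ζ v = none → ∃ i j : Fin k, i ≠ j ∧
    (∀ u : Fin n, s(v, u) ∈ E → ζ u ≠ some i) ∧
    Nat.card {u : Fin n // s(v, u) ∈ E ∧ ζ u = some j} ≤ 1)

section Aux
open scoped Classical
open Finset

/-- The probability that a Poisson variable of mean `t` is at most one. -/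
noncomputable def poissonLow (t : ℝ) : ℝ := (1 + t) * Real.exp (-t)

lemma poissonLow_anti {s t : ℝ} (ht : 0 ≤ t) (hst : t ≤ s) : poissonLow s ≤ poissonLow t := by
  unfold poissonLow
  have h1 : Real.exp (-t) = Real.exp (s - t) * Real.exp (-s) := by
    rw [← Real.exp_add]; ring_nf
  rw [h1, ← mul_assoc]
  apply mul_le_mul_of_nonneg_right _ (Real.exp_pos _).le
  nlinarith [Real.add_one_le_exp (s - t), mul_nonneg ht (sub_nonneg.2 hst)]

lemma poissonLow_nonneg {t : ℝ} (ht : 0 ≤ t) : 0 ≤ poissonLow t := by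
  unfold poissonLow; positivity

lemma poissonLow_tangent {t l : ℝ} (ht : 0 ≤ t) (hl : 5 ≤ l) :
    poissonLow l - l * Real.exp (-l) * (t - l) ≤ poissonLow t := by
  unfold poissonLow
  obtain ⟨s, rfl⟩ : ∃ s, t = l - s := ⟨l - t, by ring⟩
  have h1 : Real.exp (-(l - s)) = Real.exp s * Real.exp (-l) := by
    rw [← Real.exp_add]; ring_nf
  rw [h1]
  have key : 1 + l + l * s ≤ (1 + (l - s)) * Real.exp s := by
    rcases le_total s 0 with hs | hs
    · -- `s = -r`
      obtain ⟨r, rfl⟩ : ∃ r, s = -r := ⟨-s, by ring⟩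
      have hr : 0 ≤ r := by linarith
      have hE : 0 < Real.exp (-r) := Real.exp_pos _
      have hq : Real.exp (-r) * Real.exp r = 1 := by rw [← Real.exp_add]; simp
      by_cases h : r ≤ 6/5
      · have h3 : (1 - r/2) ^ 2 ≤ Real.exp (-r) := by
          have h4 : Real.exp (-r) = Real.exp (-(r/2)) ^ 2 := by
            rw [← Real.exp_nat_mul]; congr 1; push_cast; ring
          rw [h4]
          have := Real.one_sub_le_exp_neg (r/2)
          gcongr
          linarith
        have : (1 + (l - -r)) * (1 - r/2) ^ 2 ≤ (1 + (l - -r)) * Real.exp (-r) := by gcongr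
        nlinarith [mul_nonneg (sq_nonneg r) hr, mul_nonneg (sq_nonneg r) (sub_nonneg.2 hl)]
      · push Not at h
        have : 1 + l + l * -r ≤ 0 := by nlinarith
        have : 0 ≤ (1 + (l - -r)) * Real.exp (-r) := by positivity
        linarith
    · have hq : 1 + s + s^2/2 ≤ Real.exp s := Real.quadratic_le_exp_of_nonneg hs
      by_cases h : 1 ≤ l - s
      · have : (1 + (l - s)) * (1 + s + s^2/2) ≤ (1 + (l - s)) * Real.exp s := by gcongr
        nlinarith [mul_nonneg (sq_nonneg s) (sub_nonneg.2 h)]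
      · push Not at h
        have h4 := Real.sum_le_exp_of_nonneg hs 5
        simp [Finset.sum_range_succ, Nat.factorial] at h4
        have : Real.exp s ≤ (1 + (l - s)) * Real.exp s := by
          nlinarith [Real.exp_pos s]
        refine le_trans ?_ this
        refine le_trans ?_ h4
        have hs4 : 4 ≤ s := by linarith
        nlinarith [mul_nonneg hs hs, pow_nonneg hs 3, mul_nonneg (mul_nonneg hs hs) (sub_nonneg.2 hs4), mul_nonneg (pow_nonneg hs 3) (sub_nonneg.2 hs4)]
  have := mul_le_mul_of_nonneg_right key (Real.exp_pos (-l)).le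
  linarith

lemma factorial_mul_exp_le (M : ℕ) :
    (M.factorial : ℝ) * Real.exp M ≤ Real.exp 1 * (M + 1) * (M : ℝ) ^ M := by
  rcases Nat.eq_zero_or_pos M with rfl | hM
  · simp
  suffices h : (M.factorial : ℝ) * Real.exp M ≤ Real.exp 1 * M * (M : ℝ) ^ M by
    refine h.trans ?_
    gcongr
    linarith
  induction M, hM using Nat.le_induction with
  | base => simp
  | succ n hn ih =>
    have hn0 : (0:ℝ) < n := by exact_mod_cast hn
    have h1 : Real.exp 1 * (n:ℝ)^(n+1) ≤ ((n:ℝ)+1)^(n+1) := by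
      have h2 : Real.exp (1/((n:ℝ)+1)) ≤ ((n:ℝ)+1)/n := by
        have := Real.add_one_le_exp (-(1/((n:ℝ)+1)))
        rw [Real.exp_neg] at this
        have hp := Real.exp_pos (1/((n:ℝ)+1))
        have h3 : -(1/((n:ℝ)+1)) + 1 = n/(n+1) := by field_simp; ring
        rw [h3] at this
        rw [le_inv_comm₀ (by positivity) hp] at this
        simpa using this
      have h4 : Real.exp 1 = Real.exp (1/((n:ℝ)+1)) ^ (n+1) := by
        rw [← Real.exp_nat_mul]; congr 1; push_cast; field_simp
      rw [h4, ← mul_pow]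
      gcongr
      calc _ ≤ ((n:ℝ)+1)/n * n := by gcongr
        _ = _ := by field_simp
    rw [Nat.factorial_succ]
    push_cast
    rw [Real.exp_add]
    calc _ = ((n:ℝ)+1) * Real.exp 1 * ((n.factorial:ℝ) * Real.exp n) := by ring
      _ ≤ ((n:ℝ)+1) * Real.exp 1 * (Real.exp 1 * n * (n:ℝ)^n) := by gcongr
      _ = Real.exp 1 * ((n:ℝ)+1) * (Real.exp 1 * (n:ℝ)^(n+1)) := by ring
      _ ≤ _ := by gcongr

lemma card_fiber_counts {L α J : Type*} [Fintype L] [DecidableEq L] [Fintype α] [Fintype J] (cell : α → J)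
    (c : J → ℕ) (hc : ∑ j, c j = Fintype.card L) :
    #{w : L → α | (fun j => #{l | cell (w l) = j}) = c} =
      Nat.multinomial univ c * ∏ j, #{a | cell a = j} ^ c j := by
  have e1 : (∑ a, (MvPolynomial.X (cell a) : MvPolynomial J ℕ)) ^ Fintype.card L =
      ∑ w : L → α, ∏ j, MvPolynomial.X j ^ #{l | cell (w l) = j} := by
    rw [← Finset.card_univ, ← Finset.prod_const, Finset.prod_univ_sum, Fintype.piFinset_univ]
    refine Finset.sum_congr rfl fun w _ => ?_
    rw [← Finset.prod_fiberwise univ (fun l => cell (w l))]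
    refine Finset.prod_congr rfl fun j _ => ?_
    rw [Finset.prod_congr rfl (g := fun _ => (MvPolynomial.X j : MvPolynomial J ℕ)), Finset.prod_const]
    intro l hl
    rw [(Finset.mem_filter.1 hl).2]
  have e2 : (∑ a, (MvPolynomial.X (cell a) : MvPolynomial J ℕ)) =
      ∑ j, (#{a | cell a = j} : MvPolynomial J ℕ) * MvPolynomial.X j := by
    rw [← Finset.sum_fiberwise univ cell]
    refine Finset.sum_congr rfl fun j _ => ?_
    rw [Finset.sum_congr rfl (g := fun _ => (MvPolynomial.X j : MvPolynomial J ℕ)), Finset.sum_const,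
      nsmul_eq_mul]
    intro l hl
    rw [(Finset.mem_filter.1 hl).2]
  have e3 := congrArg (MvPolynomial.coeff (Finsupp.equivFunOnFinite.symm c)) e1
  rw [e2, Finset.sum_pow_eq_sum_piAntidiag] at e3
  simp only [MvPolynomial.coeff_sum, mul_pow, Finset.prod_mul_distrib] at e3
  have e4 : ∀ k : J → ℕ, MvPolynomial.coeff (Finsupp.equivFunOnFinite.symm c)
      (∏ j, (MvPolynomial.X j : MvPolynomial J ℕ) ^ k j) = if k = c then 1 else 0 := by
    intro k
    have : (∏ j, (MvPolynomial.X j : MvPolynomial J ℕ) ^ k j) =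
        MvPolynomial.monomial (Finsupp.equivFunOnFinite.symm k) 1 := by
      rw [MvPolynomial.monomial_eq]
      simp [Finsupp.prod_fintype]
    rw [this, MvPolynomial.coeff_monomial]
    simp
  have e5 : ∀ k : J → ℕ, MvPolynomial.coeff (Finsupp.equivFunOnFinite.symm c)
      ((Nat.multinomial univ k : MvPolynomial J ℕ) * ((∏ j, (#{a | cell a = j} : MvPolynomial J ℕ) ^ k j) *
        ∏ j, (MvPolynomial.X j : MvPolynomial J ℕ) ^ k j)) =
      if k = c then Nat.multinomial univ c * ∏ j, #{a | cell a = j} ^ c j else 0 := by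
    intro k
    have : ((Nat.multinomial univ k : MvPolynomial J ℕ) * ((∏ j, (#{a | cell a = j} : MvPolynomial J ℕ) ^ k j) *
        ∏ j, (MvPolynomial.X j : MvPolynomial J ℕ) ^ k j)) =
        MvPolynomial.C (Nat.multinomial univ k * ∏ j, #{a | cell a = j} ^ k j) *
        ∏ j, (MvPolynomial.X j : MvPolynomial J ℕ) ^ k j := by
      simp [mul_assoc]
    rw [this, MvPolynomial.coeff_C_mul, e4]
    split_ifs with h
    · simp [h]
    · simp
  simp only [e5, e4] at e3
  rw [Finset.card_filter, ← e3, Finset.sum_ite_eq', if_pos]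
  simp [Finset.mem_piAntidiag, hc]

lemma card_le_of_cell {L α J : Type*} [Fintype L] [DecidableEq L] [Fintype α] [Fintype J] (cell : α → J)
    (A : J → ℕ → Prop) (y : ℝ) (hy : 0 < y) (B : J → ℝ)
    (hB : ∀ j, ∀ N : ℕ, ∑ c ∈ range N with A j c,
      (y * #{a | cell a = j}) ^ c / (c.factorial : ℝ) ≤ B j) :
    (#{w : L → α | ∀ j, A j #{l | cell (w l) = j}} : ℝ) ≤
      (Fintype.card L).factorial / y ^ (Fintype.card L) * ∏ j, B j := by
  set M := Fintype.card L with hM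
  set S : Finset (J → ℕ) := (Finset.piAntidiag univ M).filter (fun c => ∀ j, A j (c j)) with hS
  have h1 : #{w : L → α | ∀ j, A j #{l | cell (w l) = j}} =
      ∑ c ∈ S, #{w : L → α | (fun j => #{l | cell (w l) = j}) = c} := by
    rw [Finset.card_eq_sum_card_fiberwise (f := fun w : L → α => fun j => #{l | cell (w l) = j}) (t := S)]
    · refine Finset.sum_congr rfl fun c hc => ?_
      congr 1
      ext w
      simp only [mem_filter, mem_univ, true_and, and_iff_right_iff_imp]
      rintro rfl
      exact (Finset.mem_filter.1 hc).2
    · intro w hw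
      simp only [coe_filter, mem_univ, true_and, Set.mem_ofPred_eq] at hw
      simp only [hS, coe_filter, mem_piAntidiag, Set.mem_ofPred_eq]
      refine ⟨⟨?_, by simp⟩, hw⟩
      rw [hM, ← Finset.card_univ]
      exact (Finset.card_eq_sum_card_fiberwise (fun _ _ => by simp)).symm
  rw [h1]
  push_cast
  have h2 : ∀ c ∈ S, (#{w : L → α | (fun j => #{l | cell (w l) = j}) = c} : ℝ) =
      M.factorial / y ^ M * ∏ j, (y * #{a | cell a = j}) ^ c j / ((c j).factorial : ℝ) := by
    intro c hc
    have hs : ∑ j, c j = M := by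
      simp only [hS, mem_filter, mem_piAntidiag] at hc
      exact hc.1.1
    rw [card_fiber_counts cell c hs]
    have := Nat.multinomial_spec univ c
    rw [hs] at this
    have hP : (∏ j, ((c j).factorial : ℝ)) ≠ 0 := Finset.prod_ne_zero_iff.2 fun j _ => by positivity
    have hsplit : ∏ j, (y * #{a | cell a = j}) ^ c j / ((c j).factorial : ℝ) =
        y ^ M * (∏ j, (#{a | cell a = j} : ℝ) ^ c j) / ∏ j, ((c j).factorial : ℝ) := by
      rw [Finset.prod_div_distrib, ← hs, ← Finset.prod_pow_eq_pow_sum, ← Finset.prod_mul_distrib]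
      simp only [mul_pow]
    rw [hsplit, ← this, Nat.cast_mul, Nat.cast_mul, Nat.cast_prod, Nat.cast_prod]
    simp only [Nat.cast_pow]
    generalize (∏ j, ((c j).factorial : ℝ)) = P at hP
    generalize (∏ j, (#{a | cell a = j} : ℝ) ^ c j) = D
    have := hy.ne'
    field_simp
  have hnn : ∀ j c, 0 ≤ (y * #{a | cell a = j}) ^ c / (c.factorial : ℝ) := fun j c =>
    div_nonneg (pow_nonneg (mul_nonneg hy.le (Nat.cast_nonneg _)) _) (Nat.cast_nonneg _)
  rw [Finset.sum_congr rfl h2, ← Finset.mul_sum]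
  gcongr
  calc _ ≤ ∑ c ∈ Fintype.piFinset (fun j => (range (M+1)).filter (A j)),
        ∏ j, (y * #{a | cell a = j}) ^ c j / ((c j).factorial : ℝ) := by
        apply Finset.sum_le_sum_of_subset_of_nonneg
        · intro c hc
          simp only [hS, mem_filter, mem_piAntidiag] at hc
          simp only [Fintype.mem_piFinset, mem_filter, mem_range]
          refine fun j => ⟨?_, hc.2 j⟩
          rw [← hc.1.1, Nat.lt_succ_iff]
          exact Finset.single_le_sum (f := c) (fun _ _ => Nat.zero_le _) (mem_univ j)
        · exact fun c _ _ => Finset.prod_nonneg fun j _ => hnn j (c j)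
    _ = ∏ j, ∑ c ∈ range (M+1) with A j c, (y * #{a | cell a = j}) ^ c / (c.factorial : ℝ) := by
        rw [Finset.prod_univ_sum]
    _ ≤ _ := by
        apply Finset.prod_le_prod
        · exact fun j _ => Finset.sum_nonneg fun c _ => hnn j c
        · intros j _; exact hB j _

set_option maxHeartbeats 1000000 in
lemma card_double_cover_le {L V : Type*} [Fintype L] [DecidableEq L] [Fintype V] (B : Finset V) (hB : B.Nonempty)
    {t : ℝ} (ht : 5 ≤ t) :
    (#{f : L → V | (∀ i, f i ∈ B) ∧ ∀ v ∈ B, 2 ≤ #{i | f i = v}} : ℝ) ≤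
      Real.exp 1 * (Fintype.card L + 1) *
        Real.exp (-#B * poissonLow t + t * Real.exp (-t) * (Fintype.card L - #B * t)) *
        (#B : ℝ) ^ Fintype.card L := by
  set M := Fintype.card L with hM
  rcases Nat.eq_zero_or_pos M with h0 | hpos
  · have hE : IsEmpty L := Fintype.card_eq_zero_iff.1 (hM ▸ h0)
    have : #{f : L → V | (∀ i, f i ∈ B) ∧ ∀ v ∈ B, 2 ≤ #{i | f i = v}} = 0 := by
      rw [Finset.card_eq_zero, Finset.filter_eq_empty_iff]
      rintro f - ⟨-, h⟩
      obtain ⟨v, hv⟩ := hB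
      simpa [Finset.univ_eq_empty] using h v hv
    rw [this, Nat.cast_zero]
    positivity
  have hn : (0:ℝ) < #B := by exact_mod_cast hB.card_pos
  have hM0 : (0:ℝ) < M := by exact_mod_cast hpos
  set y : ℝ := M / #B with hy
  have hy0 : 0 < y := by positivity
  have hmain := card_le_of_cell (L := L) (α := V) (J := V) id
    (fun (v : V) (c : ℕ) => if v ∈ B then 2 ≤ c else c = 0) y hy0
    (fun v => if v ∈ B then Real.exp y - 1 - y else 1) (by
      intro v N
      have hcell : #{a | id a = v} = 1 := by
        rw [Finset.card_eq_one]; exact ⟨v, by ext; simp⟩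
      rw [hcell]
      by_cases hv : v ∈ B
      · simp only [hv, if_true, Nat.cast_one, mul_one]
        have h1 : ∑ c ∈ range (N + 2) , y ^ c / (c.factorial : ℝ) ≤ Real.exp y :=
          Real.sum_le_exp_of_nonneg hy0.le _
        have h2 : ∑ c ∈ range N with 2 ≤ c, y ^ c / (c.factorial : ℝ) ≤
            ∑ c ∈ (range (N+2)).filter (2 ≤ ·), y ^ c / (c.factorial : ℝ) := by
          apply Finset.sum_le_sum_of_subset_of_nonneg
          · intro c; simp only [mem_filter, mem_range]; omega
          · intros; positivity
        have h3 : (range (N+2)).filter (fun c => ¬ 2 ≤ c) = range 2 := by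
          ext c; simp only [mem_filter, mem_range]; omega
        rw [← Finset.sum_filter_add_sum_filter_not _ (fun c => 2 ≤ c), h3] at h1
        simp [Finset.sum_range_succ] at h1
        linarith
      · simp only [hv, if_false]
        refine (Finset.sum_le_sum_of_subset_of_nonneg (t := {0}) ?_ ?_).trans ?_
        · intro c hc; simpa using (Finset.mem_filter.1 hc).2
        · intros; positivity
        · simp)
  refine (Nat.cast_le.2 (Finset.card_le_card ?_)).trans (hmain.trans ?_)
  · intro f hf
    simp only [mem_filter, mem_univ, true_and, id] at hf ⊢
    intro v
    split_ifs with hv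
    · exact hf.2 v hv
    · rw [Finset.card_eq_zero, Finset.filter_eq_empty_iff]
      rintro i - rfl
      exact hv (hf.1 i)
  rw [Finset.prod_ite_mem, Finset.univ_inter, Finset.prod_const, ← hM]
  have hpow : y ^ M = (M:ℝ) ^ M / (#B:ℝ) ^ M := by rw [hy, div_pow]
  have hq : Real.exp y - 1 - y = Real.exp y * (1 - poissonLow y) := by
    unfold poissonLow
    have : Real.exp y * Real.exp (-y) = 1 := by rw [← Real.exp_add]; simp
    linear_combination (1 + y) * this
  have hq1 : 0 ≤ 1 - poissonLow y := by
    have := poissonLow_anti le_rfl hy0.le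
    have h0 : poissonLow 0 = 1 := by simp [poissonLow]
    linarith
  have hexpM : Real.exp y ^ #B = Real.exp M := by
    rw [← Real.exp_nat_mul]; congr 1; rw [hy]; field_simp
  have hh : (1 - poissonLow y) ^ #B ≤
      Real.exp (-#B * poissonLow t + t * Real.exp (-t) * (M - #B * t)) := by
    calc (1 - poissonLow y) ^ #B ≤ (Real.exp (-poissonLow y)) ^ #B := by
          gcongr; exact Real.one_sub_le_exp_neg _
      _ = Real.exp (-#B * poissonLow y) := by rw [← Real.exp_nat_mul]; congr 1; ring
      _ ≤ _ := by
          apply Real.exp_le_exp.2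
          have := mul_le_mul_of_nonneg_left (poissonLow_tangent hy0.le ht) hn.le
          have h5 : (#B : ℝ) * y = M := by rw [hy]; field_simp
          rw [← h5]
          linarith
  have hfac := factorial_mul_exp_le M
  rw [hq, mul_pow, hexpM, hpow]
  have hMM : (0:ℝ) < (M:ℝ)^M := by positivity
  calc (M.factorial : ℝ) / ((M:ℝ) ^ M / (#B:ℝ) ^ M) * (Real.exp M * (1 - poissonLow y) ^ #B)
      = (M.factorial * Real.exp M) / (M:ℝ)^M * (1 - poissonLow y) ^ #B * (#B:ℝ)^M := by
        field_simp
    _ ≤ _ := by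
        gcongr
        rw [div_le_iff₀ hMM]
        exact hfac

lemma card_filter_and_restrict {H V : Type*} [Fintype H] [DecidableEq H] [Fintype V] (A : Finset H)
    (P : (H → V) → Prop) (hP : ∀ x x', (∀ h ∉ A, x h = x' h) → P x → P x')
    (Q : ({h // h ∈ A} → V) → Prop) :
    #{x : H → V | P x ∧ Q (fun h => x h)} =
      #{z : {h // h ∉ A} → V | ∃ x, P x ∧ (fun h : {h // h ∉ A} => x h) = z} * #{f | Q f} := by
  rw [mul_comm, ← Finset.card_product]
  apply Finset.card_bij' (fun x _ => Equiv.piEquivPiSubtypeProd (fun h => h ∈ A) (fun _ => V) x)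
    (fun p _ => (Equiv.piEquivPiSubtypeProd (fun h => h ∈ A) (fun _ => V)).symm p)
  · intro x hx
    simp only [mem_filter, mem_univ, true_and] at hx
    simp only [mem_product, mem_filter, mem_univ, true_and]
    exact ⟨hx.2, x, hx.1, rfl⟩
  · rintro ⟨f, z⟩ hp
    simp only [mem_product, mem_filter, mem_univ, true_and] at hp
    obtain ⟨hf, x, hx, rfl⟩ := hp
    simp only [mem_filter, mem_univ, true_and]
    constructor
    · refine hP x _ ?_ hx
      intro h hh
      simp [Equiv.piEquivPiSubtypeProd, hh]
    · convert hf using 2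
      rename_i h
      simp [Equiv.piEquivPiSubtypeProd]
  · intro x _; exact Equiv.symm_apply_apply _ _
  · intro p _; exact Equiv.apply_symm_apply _ _

lemma card_double_cover_restrict_le {H V : Type*} [Fintype H] [DecidableEq H] [Fintype V] (A : Finset H)
    (P : (H → V) → Prop) (hP : ∀ x x', (∀ h ∉ A, x h = x' h) → P x → P x')
    (B : Finset V) (hB : B.Nonempty) {t : ℝ} (ht : 5 ≤ t) :
    (#{x : H → V | P x ∧ (∀ h ∈ A, x h ∈ B) ∧ ∀ v ∈ B, 2 ≤ #{h ∈ A | x h = v}} : ℝ) ≤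
      Real.exp 1 * (#A + 1) *
        Real.exp (-#B * poissonLow t + t * Real.exp (-t) * (#A - #B * t)) *
        #{x : H → V | P x ∧ ∀ h ∈ A, x h ∈ B} := by
  have e1 : #{x : H → V | P x ∧ (∀ h ∈ A, x h ∈ B) ∧ ∀ v ∈ B, 2 ≤ #{h ∈ A | x h = v}} =
      #{z : {h // h ∉ A} → V | ∃ x, P x ∧ (fun h : {h // h ∉ A} => x h) = z} *
      #{f : {h // h ∈ A} → V | (∀ i, f i ∈ B) ∧ ∀ v ∈ B, 2 ≤ #{i | f i = v}} := by
    refine Eq.trans (congrArg _ ?_) ((card_filter_and_restrict A P hP fun f => (∀ i, f i ∈ B) ∧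
      ∀ v ∈ B, 2 ≤ #{i | f i = v}).trans (by congr!))
    ext x
    simp only [mem_filter, mem_univ, true_and, Subtype.forall]
    refine and_congr_right fun _ => and_congr_right fun _ => forall₂_congr fun v _ => ?_
    have : #{h ∈ A | x h = v} = #{i : {h // h ∈ A} | x i = v} := by
      rw [← Finset.card_map (Function.Embedding.subtype _)]
      congr 1
      ext h
      simp [and_comm]
    rw [this]
  have e2 : #{x : H → V | P x ∧ (∀ h ∈ A, x h ∈ B)} =
      #{z : {h // h ∉ A} → V | ∃ x, P x ∧ (fun h : {h // h ∉ A} => x h) = z} *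
      #{f : {h // h ∈ A} → V | ∀ i, f i ∈ B} := by
    refine Eq.trans (congrArg _ ?_) ((card_filter_and_restrict A P hP fun f => ∀ i, f i ∈ B).trans
      (by congr!))
    ext x
    simp only [mem_filter, mem_univ, true_and, Subtype.forall]
  rw [e1, e2]
  have := card_double_cover_le (L := {h // h ∈ A}) B hB ht
  have e3 : #{f : {h // h ∈ A} → V | ∀ i, f i ∈ B} = #B ^ #A := by
    have : ({f : {h // h ∈ A} → V | ∀ i, f i ∈ B} : Finset _) = Fintype.piFinset fun _ => B := by
      ext; simp
    rw [this, Fintype.card_piFinset]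
    simp
  rw [e3]
  rw [Fintype.card_coe] at this
  push_cast
  refine (mul_le_mul_of_nonneg_left this (Nat.cast_nonneg _)).trans (le_of_eq ?_)
  ring

/-- The other half of the pair containing the half-edge `h`. -/
def mate {m : ℕ} (h : Fin m × Bool) : Fin m × Bool := (h.1, !h.2)

lemma mate_mate {m : ℕ} (h : Fin m × Bool) : mate (mate h) = h := by
  simp [mate]

/-- No pair of the sequence `x` joins two vertices of the same nonzero color. -/
def NoMono {m k : ℕ} {V : Type*} (ζ : V → Option (Fin k)) (x : Fin m × Bool → V) : Prop :=
  ∀ h, ζ (x h) = ζ (x (mate h)) → ζ (x h) = none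

/-- Every vertex of nonzero color occurs at least twice together with every other color. -/
def SeesTwice {m k : ℕ} {V : Type*} (ζ : V → Option (Fin k)) (x : Fin m × Bool → V) : Prop :=
  ∀ a j : Fin k, j ≠ a → ∀ v, ζ v = some a → 2 ≤ #{h | x h = v ∧ ζ (x (mate h)) = some j}

/-- Every vertex of color zero occurs at most once together with some pair of colors. -/
def MissesPair {m k : ℕ} {V : Type*} (ζ : V → Option (Fin k)) (x : Fin m × Bool → V) : Prop :=
  ∀ v, ζ v = none → ∃ i j : Fin k, i < j ∧
    #{h | x h = v ∧ (ζ (x (mate h)) = some i ∨ ζ (x (mate h)) = some j)} ≤ 1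

lemma card_pattern_le {m k : ℕ} {V : Type*} [Fintype V] (ζ : V → Option (Fin k))
    (hpos : ∀ a, ({v | ζ v = some a} : Finset V).Nonempty) {t : ℝ} (ht : 5 ≤ t)
    (π : Fin m × Bool → Option (Fin k)) (S : Finset (Fin k × Fin k)) :
    (#{x : Fin m × Bool → V | ((∀ h, ζ (x h) = π h) ∧ NoMono ζ x ∧ MissesPair ζ x) ∧
      ∀ p ∈ S, ∀ v, ζ v = some p.1 → 2 ≤ #{h | (π h = some p.1 ∧ π (mate h) = some p.2) ∧ x h = v}} : ℝ) ≤
    (∏ p ∈ S, (Real.exp 1 * (#{h | π h = some p.1 ∧ π (mate h) = some p.2} + 1) *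
        Real.exp (-#{v | ζ v = some p.1} * poissonLow t + t * Real.exp (-t) *
          (#{h | π h = some p.1 ∧ π (mate h) = some p.2} - #{v | ζ v = some p.1} * t)))) *
    #{x : Fin m × Bool → V | (∀ h, ζ (x h) = π h) ∧ NoMono ζ x ∧ MissesPair ζ x} := by
  induction S using Finset.induction_on with
  | empty => simp
  | insert p S hp ih =>
    set A : Fin k × Fin k → Finset (Fin m × Bool) :=
      fun p => {h | π h = some p.1 ∧ π (mate h) = some p.2} with hA
    set P : (Fin m × Bool → V) → Prop := fun x => (∀ h ∉ A p, ζ (x h) = π h) ∧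
      (∀ h, π h = π (mate h) → π h = none) ∧
      (∀ v, ζ v = none → ∃ i j : Fin k, i < j ∧
        #{h | π h = none ∧ x h = v ∧ (π (mate h) = some i ∨ π (mate h) = some j)} ≤ 1) ∧
      ∀ q ∈ S, ∀ v, ζ v = some q.1 → 2 ≤ #{h | (π h = some q.1 ∧ π (mate h) = some q.2) ∧ x h = v}
      with hPdef
    have hequiv : ∀ x, (((∀ h, ζ (x h) = π h) ∧ NoMono ζ x ∧ MissesPair ζ x) ∧
        ∀ q ∈ S, ∀ v, ζ v = some q.1 →
          2 ≤ #{h | (π h = some q.1 ∧ π (mate h) = some q.2) ∧ x h = v}) ↔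
        (P x ∧ ∀ h ∈ A p, x h ∈ ({v | ζ v = some p.1} : Finset V)) := by
      intro x
      have hAll : (∀ h, ζ (x h) = π h) ↔ ((∀ h ∉ A p, ζ (x h) = π h) ∧
          ∀ h ∈ A p, x h ∈ ({v | ζ v = some p.1} : Finset V)) := by
        constructor
        · intro h
          refine ⟨fun i _ => h i, fun i hi => ?_⟩
          simp only [hA, mem_filter, mem_univ, true_and] at hi ⊢
          rw [h i, hi.1]
        · rintro ⟨h1, h2⟩ i
          by_cases hi : i ∈ A p
          · have := h2 i hi
            simp only [hA, mem_filter, mem_univ, true_and] at hi this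
            rw [this, hi.1]
          · exact h1 i hi
      have hM : (∀ h, ζ (x h) = π h) → (MissesPair ζ x ↔ (∀ v, ζ v = none → ∃ i j : Fin k, i < j ∧
        #{h | π h = none ∧ x h = v ∧ (π (mate h) = some i ∨ π (mate h) = some j)} ≤ 1)) := by
        intro h
        unfold MissesPair
        refine forall₂_congr fun v hv => exists₂_congr fun i j => and_congr_right fun _ => ?_
        have : ∀ e, (x e = v ∧ (ζ (x (mate e)) = some i ∨ ζ (x (mate e)) = some j)) ↔
            (π e = none ∧ x e = v ∧ (π (mate e) = some i ∨ π (mate e) = some j)) := by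
          intro e
          rw [h (mate e)]
          constructor
          · rintro ⟨rfl, h2⟩; exact ⟨by rw [← h e, hv], rfl, h2⟩
          · rintro ⟨_, h2⟩; exact h2
        simp only [this]
      have hN : (∀ h, ζ (x h) = π h) → (NoMono ζ x ↔ ∀ h, π h = π (mate h) → π h = none) := by
        intro h
        simp only [NoMono, h]
      constructor
      · rintro ⟨⟨h1, h2, h3⟩, h4⟩
        exact ⟨⟨(hAll.1 h1).1, (hN h1).1 h2, (hM h1).1 h3, h4⟩, (hAll.1 h1).2⟩
      · rintro ⟨⟨h1, h2, h3, h4⟩, h5⟩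
        have h := hAll.2 ⟨h1, h5⟩
        exact ⟨⟨h, (hN h).2 h2, (hM h).2 h3⟩, h4⟩
    have hP : ∀ x x', (∀ h ∉ A p, x h = x' h) → P x → P x' := by
      rintro x x' hx ⟨h1, h2, h3, h4⟩
      refine ⟨fun h hh => by rw [← hx h hh]; exact h1 h hh, h2, fun v hv => ?_, fun q hq v hv => ?_⟩
      · obtain ⟨i, j, hij, h⟩ := h3 v hv
        refine ⟨i, j, hij, le_of_eq_of_le ?_ h⟩
        congr 1
        ext e
        simp only [mem_filter, mem_univ, true_and]
        refine and_congr_right fun he => ?_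
        rw [hx e (by simp [hA, he])]
      · refine le_of_le_of_eq (h4 q hq v hv) ?_
        congr 1
        ext e
        simp only [mem_filter, mem_univ, true_and]
        refine and_congr_right fun he => ?_
        rw [hx e]
        simp only [hA, mem_filter, mem_univ, true_and, he.1, he.2, Option.some.injEq]
        rintro ⟨h1, h2⟩
        exact hp (Prod.ext h1.symm h2.symm ▸ hq)
    have key := card_double_cover_restrict_le (A p) P hP {v | ζ v = some p.1} (hpos p.1) ht
    rw [Finset.prod_insert hp, mul_assoc]
    refine le_trans ?_ (mul_le_mul_of_nonneg_left ih (by positivity))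
    refine le_trans (Nat.cast_le.2 (Finset.card_le_card ?_)) (key.trans (le_of_eq ?_))
    · intro x hx
      simp only [mem_filter, mem_univ, true_and, Finset.forall_mem_insert] at hx ⊢
      have := (hequiv x).1 ⟨hx.1, hx.2.2⟩
      simp only [mem_filter, mem_univ, true_and] at this
      refine ⟨this.1, this.2, fun v hv => ?_⟩
      have h2 := hx.2.1 v hv
      rwa [hA, Finset.filter_filter]
    · congr 2
      congr 1
      ext x
      simp only [mem_filter, mem_univ, true_and]
      have := hequiv x
      simp only [mem_filter, mem_univ, true_and] at this
      exact this.symm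

lemma card_seesTwice_le {m k : ℕ} {V : Type*} [Fintype V] (ζ : V → Option (Fin k))
    (hpos : ∀ a, ({v | ζ v = some a} : Finset V).Nonempty) {t : ℝ} (ht : 5 ≤ t)
    (hm : 2 * (m : ℝ) ≤ t * ((k - 1) * #{v | ζ v ≠ none})) :
    (#{x : Fin m × Bool → V | NoMono ζ x ∧ MissesPair ζ x ∧ SeesTwice ζ x} : ℝ) ≤
    (Real.exp 1 * (2 * m + 1)) ^ (k ^ 2) *
      Real.exp (-((k - 1) * #{v | ζ v ≠ none} * poissonLow t)) *
    #{x : Fin m × Bool → V | NoMono ζ x ∧ MissesPair ζ x} := by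
  set N : ℝ := ((#{v | ζ v ≠ none} : ℕ) : ℝ) with hN
  set S : Finset (Fin k × Fin k) := univ.offDiag with hS
  have hNsum : ∑ p ∈ S, (#{v | ζ v = some p.1} : ℝ) = (k - 1) * N := by
    have h1 : ∑ p ∈ S, (#{v | ζ v = some p.1} : ℝ) =
        ∑ p : Fin k × Fin k, (#{v | ζ v = some p.1} : ℝ) -
          ∑ p ∈ (univ : Finset (Fin k)).diag, (#{v | ζ v = some p.1} : ℝ) := by
      rw [eq_sub_iff_add_eq, add_comm, hS, ← Finset.sum_union (Finset.disjoint_diag_offDiag _),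
        Finset.diag_union_offDiag]
      rfl
    have h2 : ∑ a, (#{v | ζ v = some a} : ℝ) = N := by
      rw [hN]
      have : #{v | ζ v ≠ none} = ∑ a, #{v | ζ v = some a} := by
        have h4 := Finset.card_eq_sum_card_fiberwise (f := ζ) (s := ({v | ζ v ≠ none} : Finset V))
          (t := univ) (by simp)
        rw [h4, Fintype.sum_option]
        simp only [Finset.filter_filter]
        rw [show ({a | ζ a ≠ none ∧ ζ a = none} : Finset V) = ∅ by ext; simp]
        rw [Finset.card_empty, zero_add]
        refine Finset.sum_congr rfl fun a _ => ?_
        congr 1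
        ext v
        simp only [mem_filter, mem_univ, true_and, and_iff_right_iff_imp]
        intro h; simp [h]
      rw [this]; push_cast; rfl
    rw [h1, Fintype.sum_prod_type, Finset.sum_diag]
    simp only [Finset.sum_const, Finset.card_univ, Fintype.card_fin, nsmul_eq_mul]
    rw [← Finset.mul_sum, h2]
    ring
  have hpat : ∀ π : Fin m × Bool → Option (Fin k),
      (∏ p ∈ S, (Real.exp 1 * (#{h | π h = some p.1 ∧ π (mate h) = some p.2} + 1) *
        Real.exp (-#{v | ζ v = some p.1} * poissonLow t + t * Real.exp (-t) *
          (#{h | π h = some p.1 ∧ π (mate h) = some p.2} - #{v | ζ v = some p.1} * t)))) ≤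
      (Real.exp 1 * (2 * m + 1)) ^ (k ^ 2) * Real.exp (-((k - 1) * N * poissonLow t)) := by
    intro π
    have hcard : ∑ p ∈ S, (#{h | π h = some p.1 ∧ π (mate h) = some p.2} : ℝ) ≤ 2 * m := by
      have h1 : ∑ p ∈ S, #{h | π h = some p.1 ∧ π (mate h) = some p.2} ≤ 2 * m := by
        rw [← Finset.card_biUnion]
        · refine (Finset.card_le_univ _).trans ?_
          simp [mul_comm]
        · intro p _ q _ hpq
          rw [Function.onFun, Finset.disjoint_left]
          intro h hh1 hh2
          simp only [mem_filter, mem_univ, true_and] at hh1 hh2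
          apply hpq
          ext1
          · simpa [hh1.1] using hh2.1
          · simpa [hh1.2] using hh2.2
      exact_mod_cast h1
    rw [Finset.prod_mul_distrib, ← Real.exp_sum]
    have hbase : (1:ℝ) ≤ Real.exp 1 * (2 * m + 1) := by
      have h1 : (1:ℝ) ≤ Real.exp 1 := Real.one_le_exp (by norm_num)
      have h2 : (0:ℝ) ≤ m := Nat.cast_nonneg m
      nlinarith
    apply mul_le_mul _ _ (Real.exp_pos _).le (by positivity)
    · calc _ ≤ ∏ p ∈ S, (Real.exp 1 * (2 * m + 1)) := by
            apply Finset.prod_le_prod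
            · intros; positivity
            · intro p hp
              have : (#{h | π h = some p.1 ∧ π (mate h) = some p.2} : ℝ) ≤ 2 * m :=
                (Finset.single_le_sum (f := fun p : Fin k × Fin k =>
                  (#{h | π h = some p.1 ∧ π (mate h) = some p.2} : ℝ))
                  (fun _ _ => Nat.cast_nonneg _) hp).trans hcard
              gcongr
        _ = (Real.exp 1 * (2 * m + 1)) ^ #S := by rw [Finset.prod_const]
        _ ≤ _ := by
            apply pow_le_pow_right₀ hbase
            refine (Finset.card_le_univ S).trans ?_
            simp [sq]
    · apply Real.exp_le_exp.2
      rw [Finset.sum_add_distrib, ← Finset.mul_sum, Finset.sum_sub_distrib, ← Finset.sum_mul,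
        ← Finset.sum_mul, Finset.sum_neg_distrib, hNsum]
      have : t * Real.exp (-t) * (∑ p ∈ S, (#{h | π h = some p.1 ∧ π (mate h) = some p.2} : ℝ) -
          (k - 1) * N * t) ≤ 0 := by
        apply mul_nonpos_of_nonneg_of_nonpos
        · positivity
        · linarith
      linarith
  have hfib : ∀ (Q : (Fin m × Bool → V) → Prop) [DecidablePred Q], (#{x | Q x} : ℝ) =
      ∑ π : Fin m × Bool → Option (Fin k), (#{x | (∀ h, ζ (x h) = π h) ∧ Q x} : ℝ) := by
    intro Q _
    rw [Finset.card_eq_sum_card_fiberwise (f := fun x : Fin m × Bool → V => fun h => ζ (x h))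
      (t := univ) (by simp)]
    push_cast
    refine Finset.sum_congr rfl fun π _ => ?_
    congr 2
    ext x
    simp only [mem_filter, mem_univ, true_and, funext_iff, and_comm]
  rw [hfib, hfib, Finset.mul_sum]
  refine Finset.sum_le_sum fun π _ => ?_
  refine le_trans ?_ ((card_pattern_le ζ hpos ht π S).trans
    (mul_le_mul_of_nonneg_right (hpat π) (Nat.cast_nonneg _)))
  refine Nat.cast_le.2 (Finset.card_le_card ?_)
  intro x hx
  simp only [mem_filter, mem_univ, true_and] at hx ⊢
  refine ⟨⟨hx.1, hx.2.1, hx.2.2.1⟩, fun p hp v hv => ?_⟩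
  refine (hx.2.2.2 p.1 p.2 (Finset.mem_offDiag.1 hp).2.2.symm v hv).trans (Finset.card_le_card ?_)
  intro h hh
  simp only [mem_filter, mem_univ, true_and] at hh ⊢
  exact ⟨⟨by rw [← hx.1, hh.1, hv], by rw [← hx.1, hh.2]⟩, hh.1⟩

lemma card_pairs_through {V : Type*} [Fintype V] (v : V) (U : Finset V) (hv : v ∉ U) :
    #{p : V × V | (p.1 = v ∧ p.2 ∈ U) ∨ (p.2 = v ∧ p.1 ∈ U)} = 2 * #U := by
  have : ({p : V × V | (p.1 = v ∧ p.2 ∈ U) ∨ (p.2 = v ∧ p.1 ∈ U)} : Finset (V × V)) =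
      ({v} ×ˢ U) ∪ (U ×ˢ {v}) := by
    ext p
    simp only [mem_filter, mem_univ, true_and, mem_union, mem_product, mem_singleton]
    tauto
  rw [this, Finset.card_union_of_disjoint, Finset.card_product, Finset.card_product]
  · simp; ring
  · rw [Finset.disjoint_left]
    intro p hp hq
    simp only [mem_product, mem_singleton] at hp hq
    exact hv (hp.1 ▸ hq.1)

lemma card_mono_pairs {k : ℕ} {V : Type*} [Fintype V] (ζ : V → Option (Fin k)) :
    #{p : V × V | ζ p.1 = ζ p.2 ∧ ζ p.1 ≠ none} = ∑ i, #{v | ζ v = some i} ^ 2 := by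
  rw [Finset.card_eq_sum_card_fiberwise (f := fun p : V × V => ζ p.1) (t := univ) (by simp),
    Fintype.sum_option]
  rw [Finset.filter_filter, show ({a : V × V | (ζ a.1 = ζ a.2 ∧ ζ a.1 ≠ none) ∧ ζ a.1 = none} :
    Finset (V × V)) = ∅ by ext; simp, Finset.card_empty, zero_add]
  refine Finset.sum_congr rfl fun i _ => ?_
  rw [sq, ← Finset.card_product, Finset.filter_filter]
  congr 1
  ext p
  simp only [mem_filter, mem_univ, true_and, mem_product]
  constructor
  · rintro ⟨⟨h1, h2⟩, h3⟩; exact ⟨h3, h1 ▸ h3⟩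
  · rintro ⟨h1, h2⟩; simp [h1, h2]

/-- The class of a pair of vertices: monochromatic pairs, pairs joining a vertex of color zero
to its two distinguished colors, and all other pairs. -/
noncomputable def pairCell {k : ℕ} {V : Type*} (ζ : V → Option (Fin k))
    (τ : {v // ζ v = none} → {p : Fin k × Fin k // p.1 < p.2}) (p : V × V) :
    Option (Option {v // ζ v = none}) :=
  if ζ p.1 = ζ p.2 ∧ ζ p.1 ≠ none then none
  else if h : ζ p.1 = none then
    if ζ p.2 = some (τ ⟨p.1, h⟩).1.1 ∨ ζ p.2 = some (τ ⟨p.1, h⟩).1.2 then some (some ⟨p.1, h⟩)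
    else some none
  else if h : ζ p.2 = none then
    if ζ p.1 = some (τ ⟨p.2, h⟩).1.1 ∨ ζ p.1 = some (τ ⟨p.2, h⟩).1.2 then some (some ⟨p.2, h⟩)
    else some none
  else some none

section
variable {k : ℕ} {V : Type*} (ζ : V → Option (Fin k))
  (τ : {v // ζ v = none} → {p : Fin k × Fin k // p.1 < p.2})

lemma pairCell_eq_none (p : V × V) :
    pairCell ζ τ p = none ↔ (ζ p.1 = ζ p.2 ∧ ζ p.1 ≠ none) := by
  unfold pairCell
  split_ifs with h1
  · exact iff_of_true rfl h1
  all_goals exact iff_of_false (by simp) h1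

lemma pairCell_eq_some (p : V × V) (v : {v // ζ v = none}) :
    pairCell ζ τ p = some (some v) ↔
      (p.1 = v ∧ (ζ p.2 = some (τ v).1.1 ∨ ζ p.2 = some (τ v).1.2)) ∨
      (p.2 = v ∧ (ζ p.1 = some (τ v).1.1 ∨ ζ p.1 = some (τ v).1.2)) := by
  obtain ⟨a, b⟩ := p
  obtain ⟨v, hv⟩ := v
  unfold pairCell
  simp only
  constructor
  · split_ifs with h1 h2 h3 h4 h5
    · simp
    · simp only [Option.some.injEq, Subtype.mk.injEq]
      rintro rfl; exact Or.inl ⟨rfl, h3⟩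
    · simp
    · simp only [Option.some.injEq, Subtype.mk.injEq]
      rintro rfl; exact Or.inr ⟨rfl, h5⟩
    · simp
    · simp
  · rintro (⟨rfl, h⟩ | ⟨rfl, h⟩)
    · simp [hv, h]
    · have h1 : ζ a ≠ none := by rintro h0; simp [h0] at h
      simp [hv, h, h1]

lemma card_pairCell_some [Fintype V] (v : {v // ζ v = none}) :
    #{p | pairCell ζ τ p = some (some v)} =
      2 * (#{u | ζ u = some (τ v).1.1} + #{u | ζ u = some (τ v).1.2}) := by
  have hU : #{u | ζ u = some (τ v).1.1 ∨ ζ u = some (τ v).1.2} =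
      #{u | ζ u = some (τ v).1.1} + #{u | ζ u = some (τ v).1.2} := by
    rw [Finset.filter_or, Finset.card_union_of_disjoint]
    rw [Finset.disjoint_left]
    intro u h1 h2
    simp only [mem_filter, mem_univ, true_and] at h1 h2
    rw [h1, Option.some.injEq] at h2
    exact (τ v).2.ne h2
  rw [← hU, ← card_pairs_through (v : V) _ (by simp [v.2])]
  congr 1
  ext p
  simp [pairCell_eq_some]

lemma card_pairCell_rest [Fintype V] :
    (#{p | pairCell ζ τ p = some none} : ℝ) =
      ((Fintype.card V : ℝ) ^ 2 - ∑ i, (#{v | ζ v = some i} : ℝ) ^ 2) -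
        ∑ v, (#{p | pairCell ζ τ p = some (some v)} : ℝ) := by
  have h := Finset.card_eq_sum_card_fiberwise (f := pairCell ζ τ) (s := univ) (t := univ) (by simp)
  rw [Fintype.sum_option, Fintype.sum_option, Finset.card_univ, Fintype.card_prod] at h
  have h2 := card_mono_pairs ζ
  simp only [← pairCell_eq_none ζ τ] at h2
  rw [h2] at h
  have h3 := congrArg (Nat.cast (R := ℝ)) h
  push_cast at h3
  rw [sq]
  linarith

end

/-- The occupancy numbers allowed for the class `j` of pairs. -/
def pairAllowed {I : Type*} (j : Option (Option I)) (c : ℕ) : Prop :=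
  match j with
  | none => c = 0
  | some none => True
  | some (some _) => c ≤ 1

/-- The bound for the truncated exponential series of the class `j`, given its rate `a j`. -/
noncomputable def pairBound {I : Type*} (a : Option (Option I) → ℝ) (j : Option (Option I)) : ℝ :=
  match j with
  | none => 1
  | some none => Real.exp (a (some none))
  | some (some v) => 1 + a (some (some v))

lemma sum_pairAllowed_le {I : Type*} (a : Option (Option I) → ℝ) (ha : ∀ j, 0 ≤ a j)
    (j : Option (Option I)) (N : ℕ) :
    ∑ c ∈ range N with pairAllowed j c, a j ^ c / (c.factorial : ℝ) ≤ pairBound a j := by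
  have hterm : ∀ (b : ℝ) (s t : Finset ℕ), 0 ≤ b → s ⊆ t →
      ∑ c ∈ s, b ^ c / (c.factorial : ℝ) ≤ ∑ c ∈ t, b ^ c / (c.factorial : ℝ) :=
    fun b s t hb hst => Finset.sum_le_sum_of_subset_of_nonneg hst
      fun c _ _ => div_nonneg (pow_nonneg hb _) (Nat.cast_nonneg _)
  rcases j with _ | _ | v
  · refine (hterm _ _ (range 1) (ha _) ?_).trans (by simp [pairBound])
    intro c hc
    have := (Finset.mem_filter.1 hc).2
    simp only [pairAllowed] at this
    exact mem_range.2 (by omega)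
  · refine (hterm _ _ (range N) (ha _) (Finset.filter_subset _ _)).trans ?_
    exact Real.sum_le_exp_of_nonneg (ha _) _
  · refine (hterm _ _ (range 2) (ha _) ?_).trans (by simp [Finset.sum_range_succ, pairBound])
    intro c hc
    have := (Finset.mem_filter.1 hc).2
    simp only [pairAllowed] at this
    exact mem_range.2 (by omega)

lemma card_missesPair_le_sum {m k : ℕ} {V : Type*} [Fintype V] (ζ : V → Option (Fin k)) :
    #{x : Fin m × Bool → V | NoMono ζ x ∧ MissesPair ζ x} ≤
      ∑ τ : {v // ζ v = none} → {p : Fin k × Fin k // p.1 < p.2},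
        #{w : Fin m → V × V | ∀ j, pairAllowed j #{l | pairCell ζ τ (w l) = j}} := by
  refine le_trans ?_ Finset.card_biUnion_le
  refine Finset.card_le_card_of_injOn (fun x l => (x (l, false), x (l, true))) ?_ ?_
  · intro x hx
    simp only [coe_filter, mem_univ, true_and, Set.mem_ofPred_eq] at hx
    obtain ⟨h1, h2⟩ := hx
    choose i j hij hc using h2
    simp only [coe_biUnion, Set.mem_iUnion, mem_coe]
    refine ⟨fun v => ⟨(i v.1 v.2, j v.1 v.2), hij v.1 v.2⟩, mem_univ _, ?_⟩
    simp only [mem_filter, mem_univ, true_and]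
    rintro (_ | _ | v)
    · simp only [pairAllowed, Finset.card_eq_zero, Finset.filter_eq_empty_iff, mem_univ,
        true_imp_iff, pairCell_eq_none]
      rintro l ⟨h3, h4⟩
      exact h4 (h1 (l, false) h3)
    · trivial
    · simp only [pairAllowed, pairCell_eq_some]
      refine le_trans ?_ (hc v.1 v.2)
      refine Finset.card_le_card_of_injOn
        (fun l => if x (l, false) = v.1 then (l, false) else (l, true)) ?_ ?_
      · intro l hl
        simp only [coe_filter, mem_univ, true_and, Set.mem_ofPred_eq] at hl ⊢
        split_ifs with h
        · refine ⟨h, ?_⟩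
          rcases hl with hl | hl
          · exact hl.2
          · exfalso
            have := v.2
            rw [← h] at this
            rw [this] at hl
            simp at hl
        · rcases hl with hl | hl
          · exact absurd hl.1 h
          · exact hl
      · intro l _ l' _ h
        simp only at h
        have := congrArg Prod.fst h
        split_ifs at this <;> exact this
  · intro x _ x' _ h
    funext ⟨l, b⟩
    have := congrFun h l
    simp only [Prod.mk.injEq] at this
    cases b
    · exact this.1
    · exact this.2

lemma card_pairAllowed_le {m k : ℕ} {V : Type*} [Fintype V] (ζ : V → Option (Fin k)) {y : ℝ}
    (hy : 0 < y) (τ : {v // ζ v = none} → {p : Fin k × Fin k // p.1 < p.2}) :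
    (#{w : Fin m → V × V | ∀ j, pairAllowed j #{l | pairCell ζ τ (w l) = j}} : ℝ) ≤
      m.factorial / y ^ m *
      (Real.exp (y * ((Fintype.card V : ℝ) ^ 2 - ∑ i, (#{v | ζ v = some i} : ℝ) ^ 2)) *
        ∏ v, poissonLow
          (y * (2 * (#{u | ζ u = some (τ v).1.1} + #{u | ζ u = some (τ v).1.2})))) := by
  have h := card_le_of_cell (L := Fin m) (pairCell ζ τ) pairAllowed y hy
    (pairBound fun j => y * (#{p | pairCell ζ τ p = j} : ℝ)) (by
      intro j N
      convert sum_pairAllowed_le (fun j => y * (#{p | pairCell ζ τ p = j} : ℝ))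
        (fun j => mul_nonneg hy.le (Nat.cast_nonneg _)) j N)
  rw [Fintype.card_fin] at h
  refine (le_of_eq ?_).trans (h.trans (le_of_eq ?_))
  · congr!
  congr 1
  rw [Fintype.prod_option, Fintype.prod_option]
  simp only [pairBound, one_mul]
  rw [card_pairCell_rest, mul_sub, Real.exp_sub, Finset.mul_sum, Real.exp_sum,
    div_mul_eq_mul_div, mul_div_assoc, ← Finset.prod_div_distrib]
  congr 1
  refine Finset.prod_congr rfl fun v _ => ?_
  rw [card_pairCell_some]
  unfold poissonLow
  rw [Real.exp_neg]
  push_cast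
  rfl

lemma card_missesPair_le {m k : ℕ} {V : Type*} [Fintype V] (ζ : V → Option (Fin k)) {y : ℝ}
    (hy : 0 < y) :
    (#{x : Fin m × Bool → V | NoMono ζ x ∧ MissesPair ζ x} : ℝ) ≤
      m.factorial / y ^ m *
        (Real.exp (y * ((Fintype.card V : ℝ) ^ 2 - ∑ i, (#{v | ζ v = some i} : ℝ) ^ 2)) *
        (∑ p : Fin k × Fin k with p.1 < p.2,
          poissonLow (y * (2 * (#{v | ζ v = some p.1} + #{v | ζ v = some p.2})))) ^
            #{v | ζ v = none}) := by
  refine (Nat.cast_le.2 (card_missesPair_le_sum ζ)).trans ?_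
  rw [Nat.cast_sum]
  refine (Finset.sum_le_sum fun τ _ => card_pairAllowed_le ζ hy τ).trans (le_of_eq ?_)
  rw [← Finset.mul_sum, ← Finset.mul_sum]
  congr 2
  rw [← Fintype.card_subtype, ← Finset.card_univ, ← Finset.prod_const]
  rw [Finset.sum_subtype (p := fun p : Fin k × Fin k => p.1 < p.2) (h := by simp),
    Finset.prod_univ_sum, Fintype.piFinset_univ]

/-- The sequence `x` lists every edge in `E` exactly once, in one of its two orientations. -/
def Realizes {n m : ℕ} (E : Finset (Sym2 (Fin n))) (x : Fin m × Bool → Fin n) : Prop :=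
  (∀ h, s(x h, x (mate h)) ∈ E) ∧ (∀ v u, s(v, u) ∈ E → ∃ h, x h = v ∧ x (mate h) = u) ∧
    ∀ h h', s(x h, x (mate h)) = s(x h', x (mate h')) → h.1 = h'.1

section
variable {n m k : ℕ} {E : Finset (Sym2 (Fin n))} {x : Fin m × Bool → Fin n}
  {ζ : Fin n → Option (Fin k)}

lemma Realizes.noMono (hx : Realizes E x) (hζ : IsCover E ζ) : NoMono ζ x :=
  fun h hh => hζ.1 _ _ (hx.1 h) hh

lemma Realizes.seesTwice (hx : Realizes E x) (hζ : IsCover E ζ) : SeesTwice ζ x := by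
  intro a j hja v hv
  obtain ⟨u₁, u₂, hu, h1, h2, hc1, hc2⟩ := (hζ.2.1 v (by simp [hv])).2 j (by simpa [hv] using hja)
  obtain ⟨g₁, hg1, rfl⟩ := hx.2.1 _ _ h1
  obtain ⟨g₂, hg2, rfl⟩ := hx.2.1 _ _ h2
  refine Finset.one_lt_card.2 ⟨g₁, by simp [hg1, hc1], g₂, by simp [hg2, hc2], ?_⟩
  rintro rfl
  exact hu rfl

lemma Realizes.card_le_one (hx : Realizes E x) {v : Fin n} (hv : ζ v = none) {i j : Fin k}
    (hi : ∀ u : Fin n, s(v, u) ∈ E → ζ u ≠ some i)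
    (hj : Nat.card {u : Fin n // s(v, u) ∈ E ∧ ζ u = some j} ≤ 1) :
    #{h | x h = v ∧ (ζ (x (mate h)) = some i ∨ ζ (x (mate h)) = some j)} ≤ 1 := by
  rw [Finite.card_le_one_iff_subsingleton] at hj
  have key : ∀ h, x h = v → (ζ (x (mate h)) = some i ∨ ζ (x (mate h)) = some j) →
      s(v, x (mate h)) ∈ E ∧ ζ (x (mate h)) = some j := by
    rintro h rfl h2
    exact ⟨hx.1 h, h2.resolve_left (hi _ (hx.1 h))⟩
  refine Finset.card_le_one.2 fun h hh h' hh' => ?_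
  simp only [mem_filter, mem_univ, true_and] at hh hh'
  have k1 := key h hh.1 hh.2
  have k2 := key h' hh'.1 hh'.2
  have heq : x (mate h) = x (mate h') :=
    congrArg Subtype.val (Subsingleton.elim
      (⟨_, k1⟩ : {u : Fin n // s(v, u) ∈ E ∧ ζ u = some j}) ⟨_, k2⟩)
  have h1 := hx.2.2 h h' (by rw [heq, hh.1, hh'.1])
  by_contra hne
  have h2 : h' = mate h := by
    refine Prod.ext h1.symm ?_
    by_contra h3
    refine hne (Prod.ext h1 ?_)
    simp only [mate] at h3
    revert h3
    cases h.2 <;> cases h'.2 <;> simp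
  rw [← h2, hh'.1, hv] at k1
  simp at k1

lemma Realizes.missesPair (hx : Realizes E x) (hζ : IsCover E ζ) : MissesPair ζ x := by
  intro v hv
  obtain ⟨i, j, hij, hi, hj⟩ := hζ.2.2 v hv
  have h := hx.card_le_one hv hi hj
  rcases lt_or_gt_of_ne hij with h1 | h1
  · refine ⟨i, j, h1, ?_⟩
    convert h
  · refine ⟨j, i, h1, ?_⟩
    simp only [or_comm (a := ζ _ = some j)]
    convert h

end

/-- The sequence obtained from an enumeration `e` of the edges and a choice `f` of
orientations. -/
noncomputable def listing {n m : ℕ} {E : Finset (Sym2 (Fin n))} (e : Fin m ≃ E) (f : Fin m → Bool)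
    (h : Fin m × Bool) : Fin n :=
  if h.2 = f h.1 then (Quot.out (e h.1).1).1 else (Quot.out (e h.1).1).2

lemma mk_listing {n m : ℕ} {E : Finset (Sym2 (Fin n))} (e : Fin m ≃ E) (f : Fin m → Bool)
    (h : Fin m × Bool) : s(listing e f h, listing e f (mate h)) = (e h.1).1 := by
  have h0 : s((Quot.out (e h.1).1).1, (Quot.out (e h.1).1).2) = (e h.1).1 := Quot.out_eq _
  rw [← h0]
  by_cases h1 : h.2 = f h.1
  · simp [listing, mate, h1]
  · have : (!h.2) = f h.1 := by revert h1; cases h.2 <;> cases f h.1 <;> simp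
    simp only [listing, mate, this, h1, if_true, if_false]
    exact Sym2.eq_swap

lemma realizes_listing {n m : ℕ} {E : Finset (Sym2 (Fin n))} (e : Fin m ≃ E) (f : Fin m → Bool) :
    Realizes E (listing e f) := by
  refine ⟨fun h => mk_listing e f h ▸ (e h.1).2, fun v u hvu => ?_, fun h h' hh => ?_⟩
  · have h1 := mk_listing e f (e.symm ⟨_, hvu⟩, true)
    simp only [Equiv.apply_symm_apply, Sym2.eq_iff] at h1
    rcases h1 with h1 | h1
    · exact ⟨_, h1⟩
    · exact ⟨mate (e.symm ⟨_, hvu⟩, true), h1.2, by rw [mate_mate]; exact h1.1⟩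
  · rw [mk_listing, mk_listing] at hh
    exact e.injective (Subtype.ext hh)

lemma listing_injective {n m : ℕ} (P : Finset (Sym2 (Fin n)) → Prop)
    (hP : ∀ E, P E → ∀ e ∈ E, ¬ e.IsDiag) :
    Function.Injective fun t : (Σ E : {E // P E}, (Fin m ≃ E.1) × (Fin m → Bool)) =>
      listing t.2.1 t.2.2 := by
  rintro ⟨⟨E, hE⟩, e, f⟩ ⟨⟨E', hE'⟩, e', f'⟩ h
  simp only at h
  have h1 : ∀ l, (e l).1 = (e' l).1 := fun l => by
    rw [← mk_listing e f (l, true), ← mk_listing e' f' (l, true), h]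
  have h2 : E = E' := by
    ext a
    constructor
    · intro ha
      have := h1 (e.symm ⟨a, ha⟩)
      rw [Equiv.apply_symm_apply] at this
      simp only at this
      exact this ▸ (e' _).2
    · intro ha
      have := h1 (e'.symm ⟨a, ha⟩)
      rw [Equiv.apply_symm_apply] at this
      simp only at this
      exact this ▸ (e _).2
  subst h2
  have h3 : e = e' := Equiv.ext fun l => Subtype.ext (h1 l)
  subst h3
  have h4 : f = f' := by
    funext l
    by_contra hne
    have h5 := congrFun h (l, f l)
    simp only [listing, if_true, hne, if_false] at h5
    refine hP E hE _ (e l).2 ?_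
    rw [← Quot.out_eq (e l).1]
    exact h5
  subst h4
  rfl

lemma card_isCover_le {n m k : ℕ} (ζ : Fin n → Option (Fin k)) :
    Nat.card {G : GraphSpace n m // IsCover G.1 ζ} * (m.factorial * 2 ^ m) ≤
      #{x : Fin m × Bool → Fin n | NoMono ζ x ∧ MissesPair ζ x ∧ SeesTwice ζ x} := by
  set P : Finset (Sym2 (Fin n)) → Prop := fun E =>
    (E.card = m ∧ ∀ e ∈ E, ¬ e.IsDiag) ∧ IsCover E ζ with hP
  have h1 : Nat.card {G : GraphSpace n m // IsCover G.1 ζ} = Fintype.card {E // P E} := by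
    rw [← Nat.card_eq_fintype_card]
    exact Nat.card_congr (Equiv.subtypeSubtypeEquivSubtypeInter _ fun E => IsCover E ζ)
  have h2 : Fintype.card (Σ E : {E // P E}, (Fin m ≃ E.1) × (Fin m → Bool)) =
      Fintype.card {E // P E} * (m.factorial * 2 ^ m) := by
    rw [Fintype.card_sigma, Finset.sum_const_nat (m := m.factorial * 2 ^ m), Finset.card_univ]
    intro E _
    rw [Fintype.card_prod, Fintype.card_equiv (E.1.equivFinOfCardEq E.2.1.1).symm]
    simp
  rw [h1, ← h2, ← Finset.card_univ]
  refine Finset.card_le_card_of_injOn (fun t => listing t.2.1 t.2.2) ?_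
    (listing_injective P fun E hE => hE.1.2).injOn
  intro t _
  have hr := realizes_listing t.2.1 t.2.2
  simp only [coe_filter, mem_univ, true_and, Set.mem_ofPred_eq]
  exact ⟨hr.noMono t.1.2.2, hr.missesPair t.1.2.2, hr.seesTwice t.1.2.2⟩

lemma card_graphSpace (n m : ℕ) : Nat.card (GraphSpace n m) = (n.choose 2).choose m := by
  have h : Nat.card (GraphSpace n m) = #(powersetCard m ({e | ¬ e.IsDiag} : Finset (Sym2 (Fin n)))) := by
    rw [← Nat.card_eq_finsetCard]
    refine Nat.card_congr (Equiv.subtypeEquivRight fun E => ?_)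
    rw [mem_powersetCard, and_comm]
    simp [Finset.subset_iff]
  rw [h, Finset.card_powersetCard, ← Fintype.card_subtype, Sym2.card_subtype_not_diag,
    Fintype.card_fin]

lemma le_card_graphSpace (n m : ℕ) (h : 2 * (m : ℝ) + n ≤ n ^ 2) :
    ((n : ℝ) ^ 2 - n - 2 * m) ^ m ≤ Nat.card (GraphSpace n m) * (m.factorial * 2 ^ m) := by
  have h1 : (Nat.card (GraphSpace n m) * (m.factorial * 2 ^ m) : ℝ) =
      ((n.choose 2).descFactorial m : ℝ) * 2 ^ m := by
    rw [card_graphSpace, Nat.descFactorial_eq_factorial_mul_choose]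
    push_cast; ring
  rw [h1]
  have h2 := Nat.pow_sub_le_descFactorial (n.choose 2) m
  have h3 := (Nat.cast_le (α := ℝ)).2 h2
  rw [Nat.cast_pow] at h3
  refine le_trans ?_ (mul_le_mul_of_nonneg_right h3 (by positivity))
  rw [← mul_pow]
  refine pow_le_pow_left₀ (by linarith) ?_ _
  have h4 : ((n.choose 2 : ℕ) : ℝ) + 1 - m ≤ ((n.choose 2 + 1 - m : ℕ) : ℝ) := by
    have : n.choose 2 + 1 ≤ (n.choose 2 + 1 - m) + m := by omega
    have := (Nat.cast_le (α := ℝ)).2 this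
    push_cast at this
    linarith
  rw [Nat.cast_choose_two] at h4
  nlinarith

lemma card_isCover_mul_le {n m k : ℕ} (ζ : Fin n → Option (Fin k))
    (hpos : ∀ a, ({v | ζ v = some a} : Finset (Fin n)).Nonempty) {t : ℝ} (ht : 5 ≤ t)
    (hm : 2 * (m : ℝ) ≤ t * ((k - 1) * #{v | ζ v ≠ none})) (hm0 : 0 < m) {T q : ℝ}
    (hT : T = (n : ℝ) ^ 2 - ∑ i, (#{v | ζ v = some i} : ℝ) ^ 2) (hT0 : 0 < T)
    (hq : ∑ p : Fin k × Fin k with p.1 < p.2,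
      poissonLow (m / T * (2 * (#{v | ζ v = some p.1} + #{v | ζ v = some p.2}))) ≤ q) :
    (Nat.card {G : GraphSpace n m // IsCover G.1 ζ} * (m.factorial * 2 ^ m) : ℝ) ≤
      (Real.exp 1 * (2 * m + 1)) ^ (k ^ 2) *
        Real.exp (-((k - 1) * #{v | ζ v ≠ none} * poissonLow t)) *
        (Real.exp 1 * (m + 1) * T ^ m * q ^ #{v | ζ v = none}) := by
  have hm' : (0 : ℝ) < m := Nat.cast_pos.2 hm0
  have h1 := (Nat.cast_le (α := ℝ)).2 (card_isCover_le (m := m) ζ)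
  push_cast at h1
  refine h1.trans ((card_seesTwice_le ζ hpos ht hm).trans ?_)
  refine mul_le_mul_of_nonneg_left ?_ (by positivity)
  refine (card_missesPair_le ζ (div_pos hm' hT0)).trans ?_
  rw [Fintype.card_fin, ← hT, div_mul_cancel₀ _ hT0.ne', ← mul_assoc]
  have h0 : 0 ≤ ∑ p : Fin k × Fin k with p.1 < p.2,
      poissonLow (m / T * (2 * (#{v | ζ v = some p.1} + #{v | ζ v = some p.2}))) :=
    Finset.sum_nonneg fun p _ => poissonLow_nonneg (by positivity)
  refine mul_le_mul ?_ (pow_le_pow_left₀ h0 hq _) (pow_nonneg h0 _) (by positivity)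
  rw [div_pow, div_div_eq_mul_div, div_mul_eq_mul_div, div_le_iff₀ (by positivity)]
  have := mul_le_mul_of_nonneg_right (factorial_mul_exp_le m) (pow_nonneg hT0.le m)
  nlinarith

lemma sum_pow_card_none (n k : ℕ) (r : ℝ) :
    ∑ ζ : Fin n → Option (Fin k), r ^ #{v | ζ v = none} = (k + r) ^ n := by
  have h : (k + r) ^ n = ∏ _v : Fin n, ∑ c : Option (Fin k), (if c = none then r else 1) := by
    simp [Fintype.sum_option, add_comm]
  rw [h, Finset.prod_univ_sum, Fintype.piFinset_univ]
  refine Finset.sum_congr rfl fun ζ _ => ?_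
  rw [Finset.prod_ite, Finset.prod_const, Finset.prod_const_one, mul_one]

lemma one_sub_le_exp {u : ℝ} (h0 : 0 ≤ u) (h1 : u < 1) :
    1 - u ≤ Real.exp (-(u + u ^ 2 / 2)) := by
  have h : u + u ^ 2 / 2 ≤ -Real.log (1 - u) := by
    have h2 := Real.hasSum_pow_div_log_of_abs_lt_one (x := u) (by rwa [abs_of_nonneg h0])
    have h3 := sum_le_hasSum (range 2) (fun i _ => by positivity) h2
    norm_num [Finset.sum_range_succ] at h3
    exact h3
  calc 1 - u = Real.exp (Real.log (1 - u)) := (Real.exp_log (by linarith)).symm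
    _ ≤ _ := Real.exp_le_exp.2 (by linarith)

lemma sq_pow_le {n m : ℕ} {d : ℝ} (hd : 0 ≤ d) (hn : 2 * (d + 3) ≤ n) (hm : 2 * (m : ℝ) ≤ d * n + 2) :
    ((n : ℝ) ^ 2) ^ m ≤
      Real.exp ((d + 2) * (d + 3)) * ((n : ℝ) ^ 2 - n - 2 * m) ^ m := by
  have hn0 : (0 : ℝ) < n := by linarith
  set w : ℝ := (d + 3) / n with hw
  have hw0 : 0 ≤ w := by positivity
  have hw1 : w ≤ 1 / 2 := by rw [hw, div_le_iff₀ hn0]; linarith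
  have hwn : w * n = d + 3 := by rw [hw]; field_simp
  have h1 : (1 : ℝ) ≤ Real.exp (2 * w) * (1 - w) := by
    have := Real.add_one_le_exp (2 * w)
    nlinarith
  have h2 : (n : ℝ) ^ 2 * (1 - w) ≤ (n : ℝ) ^ 2 - n - 2 * m := by
    have : (n : ℝ) ^ 2 * w = (d + 3) * n := by rw [sq, mul_assoc, mul_comm (n : ℝ) w, hwn]; ring
    nlinarith
  have h3 : (n : ℝ) ^ 2 ≤ Real.exp (2 * w) * ((n : ℝ) ^ 2 - n - 2 * m) := by
    have h4 := mul_le_mul_of_nonneg_left h1 (sq_nonneg (n : ℝ))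
    have h5 := mul_le_mul_of_nonneg_left h2 (Real.exp_pos (2 * w)).le
    nlinarith
  have h6 : 0 ≤ (n : ℝ) ^ 2 - n - 2 * m := by
    refine le_trans ?_ h2
    have : 0 ≤ 1 - w := by linarith
    positivity
  refine (pow_le_pow_left₀ (sq_nonneg _) h3 m).trans ?_
  rw [mul_pow, ← Real.exp_nat_mul]
  refine mul_le_mul_of_nonneg_right (Real.exp_le_exp.2 ?_) (pow_nonneg h6 _)
  have : (m : ℝ) * (2 * w) ≤ (d * n + 2) * w := by nlinarith
  nlinarith

lemma sq_sub_sum_sq_pow_le {n m k : ℕ} (ζ : Fin n → Option (Fin k)) (hk : 2 ≤ k) (hn : 0 < n)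
    {a : ℝ} (ha : 2 ≤ a) (hm : (m : ℝ) ≤ n * (k * a + 1)) (T : ℝ)
    (hT : T = (n : ℝ) ^ 2 - ∑ i, (#{v | ζ v = some i} : ℝ) ^ 2) (hT0 : 0 ≤ T) :
    T ^ m ≤ ((n : ℝ) ^ 2) ^ m * (Real.exp (-(m * (1 / k + 1 / (2 * k ^ 2)))) *
      Real.exp (2 * a + 4 * a / k) ^ #{v | ζ v = none}) := by
  have hk' : (2 : ℝ) ≤ k := by exact_mod_cast hk
  have hn' : (0 : ℝ) < n := by exact_mod_cast hn
  have hcard : #{v | ζ v = none} + ∑ i, #{v | ζ v = some i} = n := by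
    have h := Finset.card_eq_sum_card_fiberwise (f := ζ) (s := univ) (t := univ) (by simp)
    rw [Fintype.sum_option, Finset.card_univ, Fintype.card_fin] at h
    exact h.symm
  have hcard' := congrArg (Nat.cast (R := ℝ)) hcard
  push_cast at hcard'
  set n₀ : ℕ := #{v | ζ v = none} with hn₀
  have hcs := sq_sum_le_card_mul_sum_sq (s := univ) (f := fun i : Fin k => (#{v | ζ v = some i} : ℝ))
  rw [Finset.card_univ, Fintype.card_fin] at hcs
  set S : ℝ := ∑ i, (#{v | ζ v = some i} : ℝ) ^ 2 with hS
  set N : ℝ := ∑ i : Fin k, (#{v | ζ v = some i} : ℝ) with hN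
  set z : ℝ := n₀ / n with hz
  have hz0 : 0 ≤ z := by positivity
  have hzn : z * n = n₀ := by rw [hz]; field_simp
  have hN0 : 0 ≤ N := Finset.sum_nonneg fun i _ => Nat.cast_nonneg _
  have hNz : N = n * (1 - z) := by linarith
  have hz1 : 0 ≤ 1 - z := by
    by_contra h
    push Not at h
    nlinarith
  set u : ℝ := (1 - z) ^ 2 / k with hu
  have hu0 : 0 ≤ u := by positivity
  have hu1 : u < 1 := by
    rw [hu, div_lt_one (by linarith)]
    nlinarith
  have hTu : T ≤ n ^ 2 * (1 - u) := by
    rw [hT]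
    have : (n : ℝ) ^ 2 * u ≤ S := by
      rw [hu, ← mul_div_assoc, div_le_iff₀ (by linarith), ← mul_pow, ← hNz]
      linarith
    linarith
  refine (pow_le_pow_left₀ hT0 (hTu.trans
    (mul_le_mul_of_nonneg_left (one_sub_le_exp hu0 hu1) (sq_nonneg _))) m).trans ?_
  rw [mul_pow, ← Real.exp_nat_mul, ← Real.exp_nat_mul, ← Real.exp_add]
  refine mul_le_mul_of_nonneg_left (Real.exp_le_exp.2 ?_) (by positivity)
  have e1 : 1 / k - 2 * z / k ≤ u := by
    rw [hu, ← sub_div]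
    gcongr
    nlinarith
  have e2 : 1 / (k : ℝ) ^ 2 - 4 * z / k ^ 2 ≤ u ^ 2 := by
    rw [hu, ← sub_div, div_pow]
    gcongr
    nlinarith [sq_nonneg (z - 2), sq_nonneg z, sq_nonneg (z^2 - 2 * z)]
  have e3 : (m : ℝ) * z ≤ n₀ * (k * a + 1) := by
    have := mul_le_mul_of_nonneg_left hm hz0
    calc (m : ℝ) * z ≤ z * (n * (k * a + 1)) := by linarith
      _ = z * n * (k * a + 1) := by ring
      _ = _ := by rw [hzn]
  have e4 : (m : ℝ) * (1 / k + 1 / (2 * k ^ 2)) - m * z * (2 / k + 2 / k ^ 2) ≤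
      m * (u + u ^ 2 / 2) := by
    have : (1 : ℝ) / k + 1 / (2 * k ^ 2) - z * (2 / k + 2 / k ^ 2) ≤ u + u ^ 2 / 2 := by
      have h5 : (1 : ℝ) / k + 1 / (2 * k ^ 2) - z * (2 / k + 2 / k ^ 2) =
        (1 / k - 2 * z / k) + (1 / (k : ℝ) ^ 2 - 4 * z / k ^ 2) / 2 := by ring
      linarith
    have := mul_le_mul_of_nonneg_left this (Nat.cast_nonneg (α := ℝ) m)
    linarith
  have e5 : (m : ℝ) * z * (2 / k + 2 / k ^ 2) ≤ n₀ * (2 * a + 4 * a / k) := by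
    have h6 : (k * a + 1) * (2 / k + 2 / (k : ℝ) ^ 2) ≤ 2 * a + 4 * a / k := by
      have : (k * a + 1) * (2 / k + 2 / (k : ℝ) ^ 2) =
        2 * a + (2 * a + 2 + 2 / k) / k := by field_simp; ring
      rw [this]
      have h7 : 2 / (k : ℝ) ≤ 1 := by rw [div_le_one (by linarith)]; exact hk'
      gcongr
      linarith
    calc _ ≤ n₀ * (k * a + 1) * (2 / k + 2 / (k : ℝ) ^ 2) :=
          mul_le_mul_of_nonneg_right e3 (by positivity)
      _ = n₀ * ((k * a + 1) * (2 / k + 2 / (k : ℝ) ^ 2)) := by ring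
      _ ≤ _ := mul_le_mul_of_nonneg_left h6 (Nat.cast_nonneg _)
  linarith

lemma sum_lt_le_half {k : ℕ} (g : Fin k → Fin k → ℝ) (h0 : ∀ i j, 0 ≤ g i j)
    (hsymm : ∀ i j, g i j = g j i) :
    ∑ p : Fin k × Fin k with p.1 < p.2, g p.1 p.2 ≤ (∑ i, ∑ j, g i j) / 2 := by
  have h1 : ∑ p : Fin k × Fin k with p.1 < p.2, g p.1 p.2 =
      ∑ p : Fin k × Fin k with p.2 < p.1, g p.1 p.2 := by
    refine Finset.sum_equiv (Equiv.prodComm _ _) (by simp) fun p _ => ?_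
    simpa using hsymm _ _
  have h2 : ∑ p : Fin k × Fin k with p.1 < p.2, g p.1 p.2 +
      ∑ p : Fin k × Fin k with p.2 < p.1, g p.1 p.2 ≤ ∑ p : Fin k × Fin k, g p.1 p.2 := by
    rw [← Finset.sum_union]
    · exact Finset.sum_le_sum_of_subset_of_nonneg (Finset.subset_univ _) fun p _ _ => h0 _ _
    · rw [Finset.disjoint_left]
      intro p hp hq
      exact lt_asymm (Finset.mem_filter.1 hp).2 (Finset.mem_filter.1 hq).2
  rw [Fintype.sum_prod_type] at h2
  linarith

lemma sum_poissonLow_le {k : ℕ} (f : Fin k → Fin k → ℝ) (B : Finset (Fin k)) {s₀ s₁ : ℝ}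
    (hs₀ : 0 ≤ s₀) (hs₁ : 0 ≤ s₁) (hgood : ∀ i ∉ B, ∀ j ∉ B, s₀ ≤ f i j)
    (hall : ∀ i j, s₁ ≤ f i j) :
    ∑ p : Fin k × Fin k with p.1 < p.2, poissonLow (f p.1 p.2) ≤
      k ^ 2 * poissonLow s₀ / 2 + k * #B * poissonLow s₁ := by
  have h0 := poissonLow_nonneg hs₀
  have h1 := poissonLow_nonneg hs₁
  set b : Fin k → ℝ := fun i => if i ∈ B then poissonLow s₁ else 0 with hb
  have hb0 : ∀ i, 0 ≤ b i := fun i => by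
    simp only [hb]; split_ifs
    · exact h1
    · exact le_rfl
  have hle : ∀ i j, poissonLow (f i j) ≤ poissonLow s₀ + (b i + b j) := by
    intro i j
    by_cases hi : i ∈ B
    · have h3 : b i = poissonLow s₁ := if_pos hi
      have := poissonLow_anti hs₁ (hall i j)
      linarith [hb0 j]
    by_cases hj : j ∈ B
    · have h3 : b j = poissonLow s₁ := if_pos hj
      have := poissonLow_anti hs₁ (hall i j)
      linarith [hb0 i]
    have := poissonLow_anti hs₀ (hgood i hi j hj)
    linarith [hb0 i, hb0 j]
  refine (Finset.sum_le_sum fun p _ => hle p.1 p.2).trans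
    ((sum_lt_le_half (fun i j => poissonLow s₀ + (b i + b j))
      (fun i j => by linarith [hb0 i, hb0 j]) (fun i j => by ring)).trans (le_of_eq ?_))
  have hbs : ∑ i, b i = #B * poissonLow s₁ := by
    simp [hb]
  simp only [Finset.sum_add_distrib, Finset.sum_const, Finset.card_univ, Fintype.card_fin,
    nsmul_eq_mul, ← Finset.mul_sum, hbs]
  ring

/-- The bound for `k²` times the probability that a vertex of color zero is not contradicted,
as a function of `L = ln k`. -/
noncomputable def zeroRate (L : ℝ) : ℝ :=
  (1 + 4 * L) * Real.exp (8 / L ^ 2) / 2 + L ^ 9 * (1 + 7 / 2 * L) * Real.exp (-(L / 2))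

lemma sum_poissonLow_le_zeroRate {k : ℕ} {L d g y : ℝ} {n : ℝ} (hn : 0 < n)
    (hkL : (k : ℝ) = Real.exp L) (hL : 5 ≤ L) (hLk : L ^ 3 ≤ k) (hg0 : 0 ≤ g) (hg : g ≤ 1 / 16)
    (hd : 2 * k * L - L - 1 ≤ d) (hy : d ≤ 2 * n * y) (c : Fin k → ℝ)
    (hc : ∀ i, |c i - n / k| ≤ g * n / k) (B : Finset (Fin k)) (hB : (#B : ℝ) ≤ L ^ 9)
    (hcB : ∀ i ∉ B, |c i - n / k| ≤ n / (k * L ^ 3)) :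
    ∑ p : Fin k × Fin k with p.1 < p.2, poissonLow (y * (2 * (c p.1 + c p.2))) ≤
      zeroRate L / k ^ 2 := by
  have hL0 : 0 < L := by linarith
  have hk0 : (0 : ℝ) < k := hkL ▸ Real.exp_pos L
  have hk125 : (125 : ℝ) ≤ k := by
    refine le_trans ?_ hLk
    nlinarith [pow_le_pow_left₀ (by norm_num) hL 3]
  have hd1 : 4 * L - 4 * L / k ≤ 2 * d / k := by
    rw [le_div_iff₀ hk0, sub_mul, div_mul_cancel₀ _ hk0.ne']
    nlinarith
  have hd0 : 0 < d := by nlinarith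
  have hy0 : 0 < y := by
    by_contra h
    push Not at h
    nlinarith
  have hbase : ∀ s i j, 0 ≤ s → n / k * (1 - s) ≤ c i → n / k * (1 - s) ≤ c j → s ≤ 1 →
      2 * d / k * (1 - s) ≤ y * (2 * (c i + c j)) := by
    intro s i j hs hi hj hs1
    have h1 : y * (2 * (n / k * (1 - s) + n / k * (1 - s))) ≤ y * (2 * (c i + c j)) := by
      gcongr
    refine le_trans ?_ h1
    have h2 : y * (2 * (n / k * (1 - s) + n / k * (1 - s))) = 2 * (2 * n * y) / k * (1 - s) := by
      ring
    rw [h2]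
    have : 0 ≤ 1 - s := by linarith
    gcongr
  have hL3 : 4 * L / k ≤ 4 / L ^ 2 := by
    rw [div_le_div_iff₀ hk0 (by positivity)]
    nlinarith
  have hgood : ∀ i ∉ B, ∀ j ∉ B, 4 * L - 8 / L ^ 2 ≤ y * (2 * (c i + c j)) := by
    intro i hi j hj
    have hc' : ∀ i ∉ B, n / k * (1 - 1 / L ^ 3) ≤ c i := by
      intro i hi
      have := (abs_le.1 (hcB i hi)).1
      have h3 : n / k * (1 - 1 / L ^ 3) = n / k - n / (k * L ^ 3) := by field_simp
      linarith
    have h1L : 1 / L ^ 3 ≤ 1 := by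
      rw [div_le_one (by positivity)]
      exact one_le_pow₀ (by linarith)
    refine le_trans ?_ (hbase (1 / L ^ 3) i j (by positivity) (hc' i hi) (hc' j hj) h1L)
    have h4 : (4 * L - 4 / L ^ 2) * (1 - 1 / L ^ 3) ≤ 2 * d / k * (1 - 1 / L ^ 3) :=
      mul_le_mul_of_nonneg_right (by linarith) (by linarith)
    refine le_trans ?_ h4
    have h5 : (4 * L - 4 / L ^ 2) * (1 - 1 / L ^ 3) = 4 * L - 8 / L ^ 2 + 4 / L ^ 5 := by
      field_simp; ring
    have h6 : 0 ≤ 4 / L ^ 5 := by positivity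
    linarith
  have hall : ∀ i j, 7 / 2 * L ≤ y * (2 * (c i + c j)) := by
    intro i j
    have hc' : ∀ i, n / k * (1 - g) ≤ c i := by
      intro i
      have := (abs_le.1 (hc i)).1
      have h3 : n / k * (1 - g) = n / k - g * n / k := by ring
      linarith
    refine le_trans ?_ (hbase g i j hg0 (hc' i) (hc' j) (by linarith))
    have h4 : 4 * L - 4 * L / k ≥ 4 * L * (1 - 1 / 125) := by
      have : 4 * L / k ≤ 4 * L / 125 := by gcongr
      linarith
    nlinarith
  have h8 : 8 / L ^ 2 ≤ 1 := by
    rw [div_le_one (by positivity)]; nlinarith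
  refine (sum_poissonLow_le (fun i j => y * (2 * (c i + c j))) B (by linarith) (by linarith)
    hgood hall).trans ?_
  have g0 : poissonLow (4 * L - 8 / L ^ 2) ≤ (1 + 4 * L) * Real.exp (8 / L ^ 2) / k ^ 4 := by
    unfold poissonLow
    have : Real.exp (-(4 * L - 8 / L ^ 2)) = Real.exp (8 / L ^ 2) / k ^ 4 := by
      rw [hkL, ← Real.exp_nat_mul, ← Real.exp_sub]
      congr 1; push_cast; ring
    rw [this, ← mul_div_assoc]
    have : 0 ≤ 8 / L ^ 2 := by positivity
    gcongr
    linarith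
  have g1 : poissonLow (7 / 2 * L) = (1 + 7 / 2 * L) * Real.exp (-(L / 2)) / k ^ 3 := by
    unfold poissonLow
    have : Real.exp (-(7 / 2 * L)) = Real.exp (-(L / 2)) / k ^ 3 := by
      rw [hkL, ← Real.exp_nat_mul, ← Real.exp_sub]
      congr 1; push_cast; ring
    rw [this, ← mul_div_assoc]
  have g2 : k * #B * poissonLow (7 / 2 * L) ≤
      L ^ 9 * ((1 + 7 / 2 * L) * Real.exp (-(L / 2))) / k ^ 2 := by
    rw [g1]
    calc _ = #B * ((1 + 7 / 2 * L) * Real.exp (-(L / 2))) / k ^ 2 := by field_simp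
      _ ≤ _ := by gcongr
  have g3 : (k : ℝ) ^ 2 * poissonLow (4 * L - 8 / L ^ 2) / 2 ≤
      (1 + 4 * L) * Real.exp (8 / L ^ 2) / 2 / k ^ 2 := by
    calc _ ≤ (k : ℝ) ^ 2 * ((1 + 4 * L) * Real.exp (8 / L ^ 2) / k ^ 4) / 2 := by gcongr
      _ = _ := by field_simp
  unfold zeroRate
  rw [add_div]
  have : L ^ 9 * ((1 + 7 / 2 * L) * Real.exp (-(L / 2))) / (k : ℝ) ^ 2 =
    L ^ 9 * (1 + 7 / 2 * L) * Real.exp (-(L / 2)) / k ^ 2 := by ring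
  linarith

/-- The factors in the union bound over `k`-covers that are polynomial in `n`. -/
noncomputable def polyFactor (k m : ℕ) (d : ℝ) : ℝ :=
  Real.exp ((d + 2) * (d + 3)) * ((Real.exp 1 * (2 * m + 1)) ^ (k ^ 2) * (Real.exp 1 * (m + 1)))

set_option maxHeartbeats 1000000 in
lemma card_isCover_le_rate {n m k : ℕ} (ζ : Fin n → Option (Fin k)) {L d g t : ℝ}
    (hkL : (k : ℝ) = Real.exp L) (hL : 5 ≤ L) (hLk : L ^ 3 ≤ k) (hg0 : 0 ≤ g) (hg : g ≤ 1 / 16)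
    (hd : 2 * k * L - L - 1 ≤ d) (hd' : d ≤ 2 * k * L) (hn : 2 * (d + 3) ≤ n)
    (hm : d * n / 2 ≤ m) (hm' : 2 * (m : ℝ) ≤ d * n + 2) (ht : 2 * L ≤ t)
    (htk : 2 * L * k + 1 ≤ t * ((k - 1) * (1 - Real.exp (-(2 / 3 * L)))))
    (h1 : (#{v | ζ v = none} : ℝ) ≤ n * Real.exp (-(2 / 3 * L)))
    (h2 : ∀ i, |(#{v | ζ v = some i} : ℝ) - n / k| ≤ g * n / k)
    (h3 : (#{i | n / (k * L ^ 3) < |(#{v | ζ v = some i} : ℝ) - n / k|} : ℝ) ≤ L ^ 9) :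
    (Nat.card {G : GraphSpace n m // IsCover G.1 ζ} : ℝ) ≤
      polyFactor k m d *
        (Real.exp (-(n * ((k - 1) * (1 - Real.exp (-(2 / 3 * L))) * poissonLow t))) *
          Real.exp (-(n * (d / 2 * (1 / k + 1 / (2 * k ^ 2))))) *
          (Real.exp (4 * L / k) * zeroRate L) ^ #{v | ζ v = none}) *
        Nat.card (GraphSpace n m) := by
  have hk125 : (125 : ℝ) ≤ k := by
    refine le_trans ?_ hLk
    nlinarith [pow_le_pow_left₀ (by norm_num) hL 3]
  have hk0 : (0 : ℝ) < k := by linarith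
  have hd0 : 0 < d := by nlinarith
  have hn0 : (0 : ℝ) < n := by linarith
  have hm0 : (0 : ℝ) < m := lt_of_lt_of_le (by positivity) hm
  have hcard : #{v | ζ v = none} + ∑ i, #{v | ζ v = some i} = n := by
    have h := Finset.card_eq_sum_card_fiberwise (f := ζ) (s := univ) (t := univ) (by simp)
    rw [Fintype.sum_option, Finset.card_univ, Fintype.card_fin] at h
    exact h.symm
  have hcompl : #{v | ζ v = none} + #{v | ζ v ≠ none} = n := by
    have := Finset.card_filter_add_card_filter_not (s := univ) (fun v => ζ v = none)
    simpa using this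
  have hcard' := congrArg (Nat.cast (R := ℝ)) hcard
  have hcompl' := congrArg (Nat.cast (R := ℝ)) hcompl
  push_cast at hcard' hcompl'
  have hnk : 0 < (n : ℝ) / k := by positivity
  have hub : ∀ i, (#{v | ζ v = some i} : ℝ) ≤ n / 2 := by
    intro i
    have h4 := (abs_le.1 (h2 i)).2
    have h5 : g * n / k = g * (n / k) := by ring
    have h6 : (n : ℝ) / k ≤ n / 125 := by gcongr
    nlinarith
  have hlb : ∀ i, (0 : ℝ) < #{v | ζ v = some i} := by
    intro i
    have h4 := (abs_le.1 (h2 i)).1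
    have h5 : g * n / k = g * (n / k) := by ring
    nlinarith
  have hpos : ∀ a, ({v | ζ v = some a} : Finset (Fin n)).Nonempty := fun a =>
    Finset.card_pos.1 (Nat.cast_pos.1 (hlb a))
  obtain ⟨T, hT⟩ : ∃ T : ℝ, T = (n : ℝ) ^ 2 - ∑ i, (#{v | ζ v = some i} : ℝ) ^ 2 := ⟨_, rfl⟩
  have hTn : T ≤ n ^ 2 := by
    rw [hT]
    have : 0 ≤ ∑ i, (#{v | ζ v = some i} : ℝ) ^ 2 := Finset.sum_nonneg fun i _ => sq_nonneg _
    linarith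
  have hT0 : 0 < T := by
    have h4 : ∑ i, (#{v | ζ v = some i} : ℝ) ^ 2 ≤ ∑ i, (#{v | ζ v = some i} : ℝ) * (n / 2) :=
      Finset.sum_le_sum fun i _ => by
        rw [sq]; exact mul_le_mul_of_nonneg_left (hub i) (Nat.cast_nonneg _)
    rw [← Finset.sum_mul] at h4
    have h5 : ∑ i, (#{v | ζ v = some i} : ℝ) ≤ n := by
      have : (0 : ℝ) ≤ #{v | ζ v = none} := Nat.cast_nonneg _
      linarith
    nlinarith
  have hq := sum_poissonLow_le_zeroRate hn0 hkL hL hLk hg0 hg hd (y := m / T) (by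
      rw [← mul_div_assoc, le_div_iff₀ hT0]
      nlinarith) (fun i => (#{v | ζ v = some i} : ℝ)) h2
    {i | n / (k * L ^ 3) < |(#{v | ζ v = some i} : ℝ) - n / k|} h3
    (fun i hi => by simpa using hi)
  have hN : n * (1 - Real.exp (-(2 / 3 * L))) ≤ (#{v | ζ v ≠ none} : ℝ) := by linarith
  have hseen : 2 * (m : ℝ) ≤ t * ((k - 1) * #{v | ζ v ≠ none}) := by
    have h4 : t * ((k - 1) * (n * (1 - Real.exp (-(2 / 3 * L))))) ≤
        t * ((k - 1) * #{v | ζ v ≠ none}) :=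
      mul_le_mul_of_nonneg_left (mul_le_mul_of_nonneg_left hN (by linarith)) (by linarith)
    have h5 := mul_le_mul_of_nonneg_left htk hn0.le
    have h6 := mul_le_mul_of_nonneg_right hd' hn0.le
    nlinarith
  have hmain := card_isCover_mul_le ζ hpos (by linarith : 5 ≤ t) hseen (Nat.cast_pos.1 hm0) hT hT0 hq
  have hTm := sq_sub_sum_sq_pow_le ζ (by exact_mod_cast (by linarith : (2 : ℝ) ≤ k))
    (Nat.cast_pos.1 hn0) (by linarith : 2 ≤ L) (m := m) (by nlinarith) T hT hT0.le
  have hsq := sq_pow_le hd0.le hn hm'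
  have hgs := le_card_graphSpace n m (by nlinarith)
  set F : ℝ := m.factorial * 2 ^ m with hF
  have hF0 : 0 < F := by positivity
  set X : ℝ := ((Nat.card (GraphSpace n m) : ℕ) : ℝ) with hX
  set n₀ := #{v | ζ v = none} with hn₀
  have hz0 : 0 ≤ zeroRate L := by unfold zeroRate; positivity
  have hTm' : T ^ m ≤ (Real.exp ((d + 2) * (d + 3)) * (X * F)) *
      (Real.exp (-(n * (d / 2 * (1 / k + 1 / (2 * k ^ 2))))) *
        Real.exp (2 * L + 4 * L / k) ^ n₀) := by
    refine hTm.trans (mul_le_mul ?_ ?_ (by positivity) (by positivity))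
    · exact hsq.trans (mul_le_mul_of_nonneg_left hgs (Real.exp_pos _).le)
    · refine mul_le_mul_of_nonneg_right (Real.exp_le_exp.2 (neg_le_neg ?_)) (by positivity)
      have := mul_le_mul_of_nonneg_right hm (by positivity : (0 : ℝ) ≤ 1 / k + 1 / (2 * k ^ 2))
      linarith
  have hR : Real.exp (-((k - 1) * #{v | ζ v ≠ none} * poissonLow t)) ≤
      Real.exp (-(n * ((k - 1) * (1 - Real.exp (-(2 / 3 * L))) * poissonLow t))) := by
    refine Real.exp_le_exp.2 (neg_le_neg ?_)
    have h4 := mul_le_mul_of_nonneg_right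
      (mul_le_mul_of_nonneg_left hN (by linarith : (0 : ℝ) ≤ k - 1))
      (poissonLow_nonneg (by linarith : 0 ≤ t))
    linarith
  have hrate : Real.exp (2 * L + 4 * L / k) ^ n₀ * (zeroRate L / k ^ 2) ^ n₀ =
      (Real.exp (4 * L / k) * zeroRate L) ^ n₀ := by
    rw [← mul_pow]
    congr 1
    have : Real.exp (2 * L) = k ^ 2 := by rw [hkL, ← Real.exp_nat_mul]; push_cast; rfl
    rw [Real.exp_add, this]
    field_simp
  refine le_of_mul_le_mul_right ?_ hF0
  refine hmain.trans ?_
  calc _ ≤ (Real.exp 1 * (2 * m + 1)) ^ (k ^ 2) *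
        Real.exp (-(n * ((k - 1) * (1 - Real.exp (-(2 / 3 * L))) * poissonLow t))) *
        (Real.exp 1 * (m + 1) * ((Real.exp ((d + 2) * (d + 3)) * (X * F)) *
      (Real.exp (-(n * (d / 2 * (1 / k + 1 / (2 * k ^ 2))))) *
        Real.exp (2 * L + 4 * L / k) ^ n₀)) * (zeroRate L / k ^ 2) ^ n₀) := by
        gcongr
    _ = _ := by
        rw [← hrate]
        unfold polyFactor
        ring

lemma tendsto_pow_mul_exp_neg (j : ℕ) {b : ℝ} (hb : 0 < b) :
    Tendsto (fun L : ℝ => L ^ j * Real.exp (-(b * L))) atTop (nhds 0) := by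
  have h := tendsto_rpow_mul_exp_neg_mul_atTop_nhds_zero j b hb
  refine h.congr fun L => ?_
  rw [Real.rpow_natCast, neg_mul]

lemma tendsto_exp_neg_mul {b : ℝ} (hb : 0 < b) :
    Tendsto (fun L : ℝ => Real.exp (-(b * L))) atTop (nhds 0) := by
  simpa using tendsto_pow_mul_exp_neg 0 hb

lemma tendsto_mul_exp_neg_mul {b : ℝ} (hb : 0 < b) :
    Tendsto (fun L : ℝ => L * Real.exp (-(b * L))) atTop (nhds 0) := by
  simpa using tendsto_pow_mul_exp_neg 1 hb

lemma tendsto_of_mul {w : ℝ → ℝ} (hw : Tendsto (fun L => L * w L) atTop (nhds 0)) :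
    Tendsto w atTop (nhds 0) := by
  have h := hw.mul tendsto_inv_atTop_zero
  rw [zero_mul] at h
  refine h.congr' ?_
  filter_upwards [eventually_gt_atTop 0] with L hL
  field_simp

lemma tendsto_mul_exp_sub_one {w : ℝ → ℝ} (hw : Tendsto (fun L => L * w L) atTop (nhds 0)) :
    Tendsto (fun L => L * (Real.exp (w L) - 1)) atTop (nhds 0) := by
  have hw0 := tendsto_of_mul hw
  have h1 : ∀ᶠ L in atTop, |w L| ≤ 1 := by
    have := hw0.abs
    rw [abs_zero] at this
    filter_upwards [this.eventually_lt_const one_pos] with L hL using hL.le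
  have h2 : Tendsto (fun L => 2 * |L * w L|) atTop (nhds 0) := by
    simpa using hw.abs.const_mul 2
  refine squeeze_zero_norm' ?_ h2
  filter_upwards [h1] with L hL
  rw [Real.norm_eq_abs, abs_mul, abs_mul]
  have := mul_le_mul_of_nonneg_left (Real.abs_exp_sub_one_le hL) (abs_nonneg L)
  linarith

/-- The expected order of the error in the exponent, as a function of `L = ln k`. -/
noncomputable def coverError (L : ℝ) : ℝ :=
  Real.exp (4 * L / Real.exp L) * zeroRate L + 1 / 2 -
    Real.exp L * ((Real.exp L - 1) * (1 - Real.exp (-(2 / 3 * L))) *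
      poissonLow (2 * L + Real.exp (-(1 / 2 * L)))) + (L + 1) / (4 * Real.exp L)

lemma tendsto_coverError : Tendsto coverError atTop (nhds 0) := by
  have e1 := tendsto_exp_neg_mul (b := 1) one_pos
  have e2 := tendsto_exp_neg_mul (b := 2 / 3) (by norm_num)
  have e3 := tendsto_exp_neg_mul (b := 1 / 2) (by norm_num)
  have l1 := tendsto_mul_exp_neg_mul (b := 1) one_pos
  have l2 := tendsto_mul_exp_neg_mul (b := 2 / 3) (by norm_num)
  have l3 := tendsto_mul_exp_neg_mul (b := 1 / 2) (by norm_num)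
  -- the exponential factor coming from vertices of color zero
  have hw : Tendsto (fun L : ℝ => L * (4 * L / Real.exp L + 8 / L ^ 2)) atTop (nhds 0) := by
    have h := ((tendsto_pow_mul_exp_neg 2 one_pos).const_mul 4).add
      (tendsto_inv_atTop_zero.const_mul (8 : ℝ))
    simp only [mul_zero, add_zero] at h
    refine h.congr' ?_
    filter_upwards [eventually_gt_atTop 0] with L hL
    rw [one_mul, Real.exp_neg]
    field_simp
  have w1 := tendsto_mul_exp_sub_one hw
  have w0 := tendsto_of_mul w1
  have hx : Tendsto (fun L : ℝ => Real.exp (4 * L / Real.exp L)) atTop (nhds 1) := by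
    have h := (l1.const_mul 4)
    rw [mul_zero] at h
    have h2 := (Real.continuous_exp.tendsto 0).comp h
    rw [Real.exp_zero] at h2
    refine h2.congr fun L => ?_
    simp only [Function.comp_apply, one_mul, Real.exp_neg]
    congr 1
    field_simp
  have hs : Tendsto (fun L : ℝ => L ^ 9 * (1 + 7 / 2 * L) * Real.exp (-(L / 2))) atTop (nhds 0) := by
    have h := (tendsto_pow_mul_exp_neg 9 (b := 1 / 2) (by norm_num)).add
      ((tendsto_pow_mul_exp_neg 10 (b := 1 / 2) (by norm_num)).const_mul (7 / 2))
    simp only [mul_zero, add_zero] at h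
    refine h.congr fun L => ?_
    rw [show 1 / 2 * L = L / 2 by ring]
    ring
  have hp : Tendsto (fun L : ℝ => L * (Real.exp (-Real.exp (-(1 / 2 * L))) - 1)) atTop (nhds 0) := by
    refine tendsto_mul_exp_sub_one ?_
    simpa using l3.neg
  have hp0 := tendsto_of_mul hp
  -- the product of the correction factors coming from stable vertices
  set P : ℝ → ℝ := fun L => (1 - Real.exp (-(1 * L))) * (1 - Real.exp (-(2 / 3 * L))) *
    Real.exp (-Real.exp (-(1 / 2 * L))) with hP
  have hP1 : Tendsto (fun L => L * (1 - P L)) atTop (nhds 0) := by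
    have h := (l1.add ((l2.mul (e1.const_sub 1)))).sub
      (hp.mul ((e1.const_sub 1).mul (e2.const_sub 1)))
    simp only [zero_mul, add_zero, sub_zero] at h
    refine h.congr fun L => ?_
    simp only [hP]
    ring
  have hP0 := tendsto_of_mul hP1
  have hlast : Tendsto (fun L : ℝ => (L + 1) / (4 * Real.exp L)) atTop (nhds 0) := by
    have h := (l1.add e1).div_const 4
    simp only [add_zero, zero_div] at h
    refine h.congr fun L => ?_
    rw [one_mul, Real.exp_neg]
    field_simp
  have htot := ((((w1.const_mul 2).add (w0.const_mul (1 / 2))).add (hx.mul hs)).add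
    ((hP1.const_mul 2).add hP0)).sub (e3.mul (hP0.const_sub 1))
  have htot2 := htot.add hlast
  norm_num at htot2
  refine htot2.congr fun L => ?_
  unfold coverError zeroRate poissonLow
  have hb : Real.exp (-(2 * L + Real.exp (-(1 / 2 * L)))) =
      Real.exp (-(1 * L)) * Real.exp (-(1 * L)) * Real.exp (-Real.exp (-(1 / 2 * L))) := by
    rw [← Real.exp_add, ← Real.exp_add]; congr 1; ring
  have hc : Real.exp (4 * L / Real.exp L + 8 / L ^ 2) =
      Real.exp (4 * L / Real.exp L) * Real.exp (8 / L ^ 2) := Real.exp_add _ _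
  have hd : Real.exp L * Real.exp (-(1 * L)) = 1 := by
    rw [← Real.exp_add]; simp
  rw [hb, hc]
  simp only [hP]
  simp only [one_mul] at hd ⊢
  generalize Real.exp (4 * L / Real.exp L) = x
  generalize Real.exp (8 / L ^ 2) = z
  generalize Real.exp (-(2 / 3 * L)) = a
  generalize Real.exp (-Real.exp (-(1 / 2 * L))) = c
  generalize Real.exp (-(1 / 2 * L)) = b
  generalize Real.exp (-(L / 2)) = e
  generalize (L + 1) / (4 * Real.exp L) = s
  generalize Real.exp L = X at *
  generalize Real.exp (-L) = Y at *
  linear_combination (1 - a) * (1 + 2 * L + b) * c * (X * Y + 1 - Y) * hd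

lemma eventually_seen : ∀ᶠ L : ℝ in atTop, 2 * L * Real.exp L + 1 ≤
    (2 * L + Real.exp (-(1 / 2 * L))) * ((Real.exp L - 1) * (1 - Real.exp (-(2 / 3 * L)))) := by
  have e1 := tendsto_exp_neg_mul (b := 1) one_pos
  have e2 := tendsto_exp_neg_mul (b := 2 / 3) (by norm_num)
  have l1 := tendsto_mul_exp_neg_mul (b := 1 / 2) (by norm_num)
  have l2 := tendsto_mul_exp_neg_mul (b := 1 / 6) (by norm_num)
  have l3 := tendsto_mul_exp_neg_mul (b := 7 / 6) (by norm_num)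
  have h := ((((l3.const_mul 2).sub (l1.const_mul 2)).sub (l2.const_mul 2)).add
    ((e1.const_sub 1).mul (e2.const_sub 1)))
  norm_num at h
  filter_upwards [h.eventually_const_lt (show (1 / 2 : ℝ) < 1 by norm_num),
    eventually_ge_atTop 2] with L hL hL2
  obtain ⟨a, ha⟩ : ∃ a, a = Real.exp (1 / 6 * L) := ⟨_, rfl⟩
  have ha0 : 0 < a := ha ▸ Real.exp_pos _
  have k1 : Real.exp L = a ^ 6 := by rw [ha, ← Real.exp_nat_mul]; congr 1; push_cast; ring
  have k2 : Real.exp (-(1 / 2 * L)) = (a ^ 3)⁻¹ := by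
    rw [ha, ← Real.exp_nat_mul, ← Real.exp_neg]; congr 1; push_cast; ring
  have k3 : Real.exp (-(2 / 3 * L)) = (a ^ 4)⁻¹ := by
    rw [ha, ← Real.exp_nat_mul, ← Real.exp_neg]; congr 1; push_cast; ring
  have k4 : Real.exp (-L) = (a ^ 6)⁻¹ := by rw [Real.exp_neg, k1]
  have k5 : Real.exp (-(7 / 6 * L)) = (a ^ 7)⁻¹ := by
    rw [ha, ← Real.exp_nat_mul, ← Real.exp_neg]; congr 1; push_cast; ring
  have k6 : Real.exp (-(1 / 6 * L)) = a⁻¹ := by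
    rw [ha, ← Real.exp_neg]
  have ha3 : 2 ≤ a ^ 3 := by
    rw [ha, ← Real.exp_nat_mul]
    have := Real.add_one_le_exp ((3 : ℕ) * (1 / 6 * L))
    push_cast at this ⊢
    linarith
  rw [k2, k3, k4, k5, k6] at hL
  rw [k1, k2, k3]
  have hid : (2 * L + (a ^ 3)⁻¹) * ((a ^ 6 - 1) * (1 - (a ^ 4)⁻¹)) - 2 * L * a ^ 6 =
      a ^ 3 * (2 * (L * (a ^ 7)⁻¹) - 2 * (L * (a ^ 3)⁻¹) - 2 * (L * a⁻¹) +
        (1 - (a ^ 6)⁻¹) * (1 - (a ^ 4)⁻¹)) := by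
    field_simp
    ring
  nlinarith

lemma card_exists_isCover_le {n m k : ℕ} (Q : (Fin n → Option (Fin k)) → Prop) {C r X : ℝ}
    (hC : 0 ≤ C) (hr : 0 ≤ r) (hX : 0 ≤ X)
    (h : ∀ ζ, Q ζ → (Nat.card {G : GraphSpace n m // IsCover G.1 ζ} : ℝ) ≤
      C * r ^ #{v | ζ v = none} * X) :
    (Nat.card {G : GraphSpace n m // ∃ ζ : Fin n → Option (Fin k), IsCover G.1 ζ ∧ Q ζ} : ℝ) ≤
      C * (k + r) ^ n * X := by
  have : Finite (GraphSpace n m) :=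
    inferInstanceAs (Finite {E : Finset (Sym2 (Fin n)) // E.card = m ∧ ∀ e ∈ E, ¬ e.IsDiag})
  have := Fintype.ofFinite (GraphSpace n m)
  have h1 : Nat.card {G : GraphSpace n m // ∃ ζ : Fin n → Option (Fin k), IsCover G.1 ζ ∧ Q ζ} ≤
      ∑ ζ with Q ζ, Nat.card {G : GraphSpace n m // IsCover G.1 ζ} := by
    simp only [Nat.card_eq_fintype_card, Fintype.card_subtype]
    refine le_trans (Finset.card_le_card ?_) Finset.card_biUnion_le
    intro G hG
    obtain ⟨ζ, h1, h2⟩ := (Finset.mem_filter.1 hG).2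
    exact Finset.mem_biUnion.2 ⟨ζ, by simpa using h2, by simpa using h1⟩
  rw [← sum_pow_card_none, Finset.mul_sum, Finset.sum_mul]
  refine (Nat.cast_le.2 h1).trans ?_
  rw [Nat.cast_sum]
  refine (Finset.sum_le_sum fun ζ hζ => h ζ (by simpa using hζ)).trans ?_
  exact Finset.sum_le_sum_of_subset_of_nonneg (Finset.subset_univ _)
    fun ζ _ _ => mul_nonneg (mul_nonneg hC (pow_nonneg hr _)) hX

lemma one_sub_le_prob_not {Ω : Type*} [Finite Ω] [Nonempty Ω] (p : Ω → Prop) {b : ℝ}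
    (h : (Nat.card {x // p x} : ℝ) ≤ b * Nat.card Ω) : 1 - b ≤ prob fun x => ¬ p x := by
  have := Fintype.ofFinite Ω
  have h0 : (0 : ℝ) < Nat.card Ω := Nat.cast_pos.2 Nat.card_pos
  unfold prob
  rw [le_div_iff₀ h0]
  have h1 : Nat.card {x // p x} + Nat.card {x // ¬ p x} = Nat.card Ω := by
    simp only [Nat.card_eq_fintype_card]
    rw [Fintype.card_subtype_compl]
    have := Fintype.card_subtype_le p
    omega
  have h2 := congrArg (Nat.cast (R := ℝ)) h1
  push_cast at h2
  linarith

lemma prob_le_one {Ω : Type*} [Finite Ω] (p : Ω → Prop) : prob p ≤ 1 := by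
  unfold prob
  refine div_le_one_of_le₀ ?_ (Nat.cast_nonneg _)
  exact_mod_cast Nat.card_le_card_of_injective _ (Subtype.val_injective (p := p))

lemma exponent_le {k : ℕ} {L d e : ℝ} (hkL : (k : ℝ) = Real.exp L) (hL : 5 ≤ L)
    (he : e = 2 * |coverError L| + 2 / (k + 1)) (hd : 2 * k * L - L - 1 + e ≤ d) (n : ℕ) :
    Real.exp (-(n * ((k - 1) * (1 - Real.exp (-(2 / 3 * L))) *
        poissonLow (2 * L + Real.exp (-(1 / 2 * L)))))) *
      Real.exp (-(n * (d / 2 * (1 / k + 1 / (2 * k ^ 2))))) *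
      (k + Real.exp (4 * L / k) * zeroRate L) ^ n ≤ Real.exp (-(1 / (k * (k + 1)) * n)) := by
  have hk0 : (0 : ℝ) < k := hkL ▸ Real.exp_pos L
  set A : ℝ := (k - 1) * (1 - Real.exp (-(2 / 3 * L))) *
    poissonLow (2 * L + Real.exp (-(1 / 2 * L))) with hA
  set ρ : ℝ := Real.exp (4 * L / k) * zeroRate L with hρ
  have hρ0 : 0 ≤ ρ := by
    rw [hρ]; unfold zeroRate; positivity
  have herr : coverError L = ρ + 1 / 2 - k * A + (L + 1) / (4 * k) := by
    rw [hρ, hA, hkL]; rfl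
  have h1 : (k : ℝ) + ρ ≤ Real.exp (L + ρ / k) := by
    rw [Real.exp_add, ← hkL]
    have := mul_le_mul_of_nonneg_left (Real.add_one_le_exp (ρ / k)) hk0.le
    rwa [mul_add, mul_div_cancel₀ _ hk0.ne', mul_one, add_comm] at this
  have h2 : (k : ℝ) * (L + ρ / k - A - d / 2 * (1 / k + 1 / (2 * k ^ 2))) ≤ -(1 / (k + 1)) := by
    have e0 : 0 ≤ e := by rw [he]; positivity
    have e1 : (k : ℝ) * (L + ρ / k - A - d / 2 * (1 / k + 1 / (2 * k ^ 2))) =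
        k * L + (ρ - k * A) - d / 2 * (1 + 1 / (2 * k)) := by
      field_simp
      ring
    have e2 : (2 * k * L - L - 1 + e) / 2 * (1 + 1 / (2 * k)) =
        k * L - 1 / 2 - (L + 1) / (4 * k) + e / 2 + e / (4 * k) := by
      field_simp; ring
    have e3 : (2 * k * L - L - 1 + e) / 2 * (1 + 1 / (2 * k)) ≤ d / 2 * (1 + 1 / (2 * (k : ℝ))) := by
      gcongr
    have e4 : 0 ≤ e / (4 * k) := by positivity
    have e5 := le_abs_self (coverError L)
    have e6 : 2 / ((k : ℝ) + 1) = 2 * (1 / (k + 1)) := by ring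
    rw [e1]
    linarith
  have h3 : L + ρ / k - A - d / 2 * (1 / k + 1 / (2 * k ^ 2)) ≤ -(1 / (k * (k + 1))) := by
    have : -(1 / ((k : ℝ) * (k + 1))) = -(1 / (k + 1)) / k := by field_simp
    rw [this, le_div_iff₀ hk0]
    linarith
  refine (mul_le_mul_of_nonneg_left (pow_le_pow_left₀ (by positivity) h1 n)
    (by positivity)).trans ?_
  rw [← Real.exp_nat_mul, ← Real.exp_add, ← Real.exp_add]
  refine Real.exp_le_exp.2 ?_
  have := mul_le_mul_of_nonneg_left h3 (Nat.cast_nonneg (α := ℝ) n)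
  linarith

lemma tendsto_polyFactor_mul_exp (k : ℕ) {d c : ℝ} (hd : 0 ≤ d) (hc : 0 < c) :
    Tendsto (fun n : ℕ => polyFactor k ⌈d * n / 2⌉₊ d * Real.exp (-(c * n))) atTop (nhds 0) := by
  have h := ((tendsto_pow_mul_exp_neg (k ^ 2 + 1) hc).comp tendsto_natCast_atTop_atTop).const_mul
    (Real.exp ((d + 2) * (d + 3)) * (Real.exp 1 * (d + 3)) ^ (k ^ 2 + 1))
  rw [mul_zero] at h
  refine squeeze_zero' (Eventually.of_forall fun n => ?_) ?_ h
  · unfold polyFactor; positivity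
  · filter_upwards [eventually_ge_atTop 1] with n hn
    have hn' : (1 : ℝ) ≤ n := by exact_mod_cast hn
    have hm : (⌈d * n / 2⌉₊ : ℝ) ≤ d * n / 2 + 1 :=
      (Nat.ceil_lt_add_one (by positivity)).le
    have h1 : 2 * (⌈d * n / 2⌉₊ : ℝ) + 1 ≤ (d + 3) * n := by nlinarith
    have h2 : (⌈d * n / 2⌉₊ : ℝ) + 1 ≤ (d + 3) * n := by
      have : (0 : ℝ) ≤ ⌈d * n / 2⌉₊ := Nat.cast_nonneg _
      linarith
    unfold polyFactor
    calc _ ≤ Real.exp ((d + 2) * (d + 3)) * ((Real.exp 1 * ((d + 3) * n)) ^ (k ^ 2) *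
          (Real.exp 1 * ((d + 3) * n))) * Real.exp (-(c * n)) := by gcongr
      _ = _ := by
        rw [← pow_succ, ← mul_assoc (Real.exp 1), mul_pow, Function.comp_apply]
        ring

lemma le_prob_not_exists_isCover {k : ℕ} {d e g : ℝ} (hL : 5 ≤ Real.log k)
    (hLk : Real.log k ^ 3 ≤ k) (hg0 : 0 ≤ g) (hg : g ≤ 1 / 16)
    (hseen : 2 * Real.log k * k + 1 ≤ (2 * Real.log k + Real.exp (-(1 / 2 * Real.log k))) *
      ((k - 1) * (1 - Real.exp (-(2 / 3 * Real.log k)))))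
    (he : e = 2 * |coverError (Real.log k)| + 2 / (k + 1))
    (hd : 2 * k * Real.log k - Real.log k - 1 + e ≤ d) (hd' : d ≤ 2 * k * Real.log k) {n : ℕ}
    (hn : 2 * (d + 3) ≤ n) :
    1 - polyFactor k ⌈d * n / 2⌉₊ d * Real.exp (-(1 / (k * (k + 1)) * n)) ≤
      prob (fun G : GraphSpace n ⌈d * n / 2⌉₊ =>
        ¬ ∃ ζ : Fin n → Option (Fin k), IsCover G.1 ζ ∧
          ((Nat.card {v : Fin n // ζ v = none} : ℝ) ≤ n * (k : ℝ) ^ (-(2 : ℝ) / 3)) ∧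
          (∀ i : Fin k, |(Nat.card {v : Fin n // ζ v = some i} : ℝ) - n / k| ≤ g * n / k) ∧
          ((Nat.card {i : Fin k // n / (k * Real.log k ^ (3 : ℕ)) <
              |(Nat.card {v : Fin n // ζ v = some i} : ℝ) - n / k|} : ℝ)
            ≤ Real.log k ^ (9 : ℕ))) := by
  have hL' := hL
  have hk0 : (0 : ℝ) < k := by
    refine lt_of_lt_of_le ?_ hLk
    positivity
  have hkL : (k : ℝ) = Real.exp (Real.log k) := (Real.exp_log hk0).symm
  have hk1 : (125 : ℝ) ≤ k := by
    refine le_trans ?_ hLk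
    nlinarith [pow_le_pow_left₀ (by norm_num) hL 3]
  have e0 : 0 ≤ e := by rw [he]; positivity
  have hd0 : 0 < d := by nlinarith
  have hn0 : (0 : ℝ) < n := by linarith
  have hm1 : d * n / 2 ≤ (⌈d * n / 2⌉₊ : ℝ) := Nat.le_ceil _
  have hm2 : (⌈d * n / 2⌉₊ : ℝ) ≤ d * n / 2 + 1 := (Nat.ceil_lt_add_one (by positivity)).le
  have hrpow : (k : ℝ) ^ (-(2 : ℝ) / 3) = Real.exp (-(2 / 3 * Real.log k)) := by
    rw [Real.rpow_def_of_pos hk0]; congr 1; ring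
  generalize ⌈d * n / 2⌉₊ = m at hm1 hm2 ⊢
  set L := Real.log k with hLdef
  have : Finite (GraphSpace n m) :=
    inferInstanceAs (Finite {E : Finset (Sym2 (Fin n)) // E.card = m ∧ ∀ e ∈ E, ¬ e.IsDiag})
  have hne : Nonempty (GraphSpace n m) := by
    have h1 := le_card_graphSpace n m (by nlinarith)
    have h2 : 0 < ((n : ℝ) ^ 2 - n - 2 * m) ^ m := pow_pos (by nlinarith) _
    have h3 : (0 : ℝ) < Nat.card (GraphSpace n m) :=
      pos_of_mul_pos_left (lt_of_lt_of_le h2 h1) (by positivity)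
    exact (Nat.card_pos_iff.1 (Nat.cast_pos.1 h3)).1
  refine one_sub_le_prob_not _ ?_
  refine (card_exists_isCover_le _ (C := polyFactor k m d *
        (Real.exp (-(n * ((k - 1) * (1 - Real.exp (-(2 / 3 * L))) *
          poissonLow (2 * L + Real.exp (-(1 / 2 * L)))))) *
          Real.exp (-(n * (d / 2 * (1 / k + 1 / (2 * k ^ 2)))))))
      (r := Real.exp (4 * L / k) * zeroRate L) (X := Nat.card (GraphSpace n m))
      (by unfold polyFactor; positivity) (by unfold zeroRate; positivity) (Nat.cast_nonneg _) ?_).trans ?_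
  · rintro ζ ⟨h1, h2, h3⟩
    simp only [Nat.card_eq_fintype_card (α := {v : Fin n // _}), Fintype.card_subtype,
      Nat.card_eq_fintype_card (α := {v : Fin k // _}), hrpow] at h1 h2 h3
    refine (card_isCover_le_rate ζ hkL hL hLk hg0 hg (by linarith) hd' hn hm1 (by linarith)
      (t := 2 * L + Real.exp (-(1 / 2 * L))) (by linarith [Real.exp_pos (-(1 / 2 * L))]) hseen
      h1 h2 ?_).trans (le_of_eq ?_)
    · convert h3
    · ring
  · have := exponent_le hkL hL he hd n
    refine mul_le_mul_of_nonneg_right ?_ (Nat.cast_nonneg _)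
    rw [mul_assoc]
    exact mul_le_mul_of_nonneg_left this (by unfold polyFactor; positivity)

end Aux

theorem statement7 (γ : ℕ → ℝ) (hγpos : ∀ k, 0 < γ k)
    (hγ : Tendsto γ atTop (nhds 0)) :
    ∃ (k₀ : ℕ) (ε : ℕ → ℝ), (∀ k, 0 < ε k) ∧ Tendsto ε atTop (nhds 0) ∧
      ∀ k : ℕ, k₀ ≤ k → ∀ d : ℝ,
        2 * k * Real.log k - Real.log k - 1 + ε k ≤ d → d ≤ 2 * k * Real.log k →
        Tendsto (fun n : ℕ =>
            prob (fun G : GraphSpace n ⌈d * n / 2⌉₊ =>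
              ¬ ∃ ζ : Fin n → Option (Fin k), IsCover G.1 ζ ∧
                -- (1): `|ζ⁻¹(0)| ≤ n·k^(−2/3)`
                ((Nat.card {v : Fin n // ζ v = none} : ℝ) ≤ n * (k : ℝ) ^ (-(2 : ℝ) / 3)) ∧
                -- (2): `| |ζ⁻¹(i)| − n/k | ≤ γ k · n/k` for all colors `i`
                (∀ i : Fin k,
                  |(Nat.card {v : Fin n // ζ v = some i} : ℝ) - n / k| ≤ γ k * n / k) ∧
                -- (3): at most `(ln k)^9` colors deviate by more than `n/(k (ln k)^3)`
                ((Nat.card {i : Fin k //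
                    n / (k * Real.log k ^ (3 : ℕ)) <
                      |(Nat.card {v : Fin n // ζ v = some i} : ℝ) - n / k|} : ℝ)
                  ≤ Real.log k ^ (9 : ℕ))))
          atTop (nhds 1) := by
  have hlog : Tendsto (fun k : ℕ => Real.log k) atTop atTop :=
    Real.tendsto_log_atTop.comp tendsto_natCast_atTop_atTop
  have hcube : ∀ᶠ L : ℝ in atTop, L ^ 3 ≤ Real.exp L := by
    have h := tendsto_pow_mul_exp_neg 3 one_pos
    filter_upwards [h.eventually_lt_const one_pos] with L hL
    rw [one_mul, Real.exp_neg, ← div_eq_mul_inv, div_lt_one (Real.exp_pos L)] at hL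
    exact hL.le
  obtain ⟨k₀, hk₀⟩ := eventually_atTop.1 ((eventually_ge_atTop 1).and
    ((hlog.eventually (((eventually_ge_atTop 5).and hcube).and eventually_seen)).and
      (hγ.eventually_le_const (show (0 : ℝ) < 1 / 16 by norm_num))))
  refine ⟨k₀, fun k => 2 * |coverError (Real.log k)| + 2 / (k + 1), fun k => by positivity, ?_, ?_⟩
  · have h1 := (tendsto_coverError.comp hlog).abs.const_mul 2
    have h2 := (tendsto_one_div_add_atTop_nhds_zero_nat (𝕜 := ℝ)).const_mul 2
    have h3 := h1.add h2
    simp only [abs_zero, mul_zero, add_zero] at h3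
    refine h3.congr fun k => ?_
    simp only [Function.comp_apply]
    ring
  · intro k hk d hd hd'
    obtain ⟨hk1, ⟨⟨hL, hLk⟩, hseen⟩, hg⟩ := hk₀ k hk
    have hk0 : (0 : ℝ) < k := Nat.cast_pos.2 hk1
    rw [Real.exp_log hk0] at hLk hseen
    have hd0 : 0 ≤ d := by
      refine le_trans ?_ hd
      have h1 : (0 : ℝ) ≤ 2 * |coverError (Real.log k)| + 2 / (k + 1) := by positivity
      have h2 : (1 : ℝ) ≤ k := by exact_mod_cast hk1
      nlinarith
    have hlow : Tendsto (fun n : ℕ => 1 - polyFactor k ⌈d * n / 2⌉₊ d *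
        Real.exp (-(1 / (k * (k + 1)) * n))) atTop (nhds 1) := by
      simpa using (tendsto_polyFactor_mul_exp k hd0
        (by positivity : (0 : ℝ) < 1 / (k * (k + 1)))).const_sub 1
    refine tendsto_of_tendsto_of_tendsto_of_le_of_le' hlow tendsto_const_nhds ?_ ?_
    · filter_upwards [tendsto_natCast_atTop_atTop.eventually_ge_atTop (2 * (d + 3))] with n hn
      exact le_prob_not_exists_isCover hL hLk (hγpos k).le hg hseen rfl hd hd' hn
    · refine Eventually.of_forall fun n => ?_
      have : Finite (GraphSpace n ⌈d * n / 2⌉₊) := inferInstanceAs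
        (Finite {E : Finset (Sym2 (Fin n)) // E.card = ⌈d * n / 2⌉₊ ∧ ∀ e ∈ E, ¬ e.IsDiag})
      exact prob_le_one _
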